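/- There exists a constant C₄ > 0 such that, for every admissible realization of the exploration at stage k and every choice of prescribed values defining the events H_=, H₊, H₋, one has Var( X₃ | H_=, H₊, H₋ ) ≤ C₄ / log N, where X₃ = |∂V_{(1+β)N/2}|^{−1} Σ_{u ∈ ∂V_{(1+β)N/2}} Σ_{v ∈ J₃} H̃m'(u, v; Explored_k ∪ ∂V_N) · η̃'_{N,v}. -/

import Mathlib

open MeasureTheory ProbabilityTheory Set

attribute [local instance] Classical.propDecidable

noncomputable section


/-! ### The lattice boxes `V_N`, adjacency, boundary -/

/-- The `N × N` box `V_N ⊆ ℤ²`, centered at the origin or at `(1/2,1/2)` according to the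
parity of `N`. -/
def box (N : ℕ) : Finset (ℤ × ℤ) :=
  Finset.Icc (-(((N : ℤ) - 1) / 2)) ((N : ℤ) / 2) ×ˢ
    Finset.Icc (-(((N : ℤ) - 1) / 2)) ((N : ℤ) / 2)

/-- `V_x = V_{⌊x⌋}` for real `x`. -/
def boxR (x : ℝ) : Finset (ℤ × ℤ) := box ⌊x⌋₊

/-- Nearest-neighbour adjacency on `ℤ²`. -/
def adj (u v : ℤ × ℤ) : Prop := |u.1 - v.1| + |u.2 - v.2| = 1

/-- The four lattice neighbours of a point. -/
def nbrs (u : ℤ × ℤ) : Finset (ℤ × ℤ) :=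
  {(u.1 + 1, u.2), (u.1 - 1, u.2), (u.1, u.2 + 1), (u.1, u.2 - 1)}

/-- The (inner) boundary `∂V_N`. -/
def bdry (N : ℕ) : Finset (ℤ × ℤ) :=
  (box N).filter fun v => ∃ u ∈ nbrs v, u ∉ box N

/-- `∂V_x = ∂V_{⌊x⌋}` for real `x`. -/
def bdryR (x : ℝ) : Finset (ℤ × ℤ) := bdry ⌊x⌋₊

/-! ### Simple random walk: killed transition kernel, Green's function, harmonic measure -/

/-- `killedStep K n u v` is the probability that simple random walk started at `u` is at `v`
at time `n` without having visited the killing set `K` at any time `≤ n`. -/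
def killedStep (K : Set (ℤ × ℤ)) : ℕ → (ℤ × ℤ) → (ℤ × ℤ) → ℝ
  | 0, u, v => if u = v ∧ u ∉ K then 1 else 0
  | n + 1, u, v => if u ∈ K then 0 else (1 / 4) * ∑ w ∈ nbrs u, killedStep K n w v

/-- Green's function of simple random walk killed on the set `K`: the expected number of
visits to `v` strictly before hitting `K`, for the walk started at `u`. -/
def greenK (K : Set (ℤ × ℤ)) (u v : ℤ × ℤ) : ℝ := ∑' n, killedStep K n u v

/-- `G_{V_N}(u,v)`: Green's function of simple random walk killed at `∂V_N`. -/
def green (N : ℕ) (u v : ℤ × ℤ) : ℝ := greenK (↑(bdry N)) u v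

/-- `hitStep A n v u` is the probability that simple random walk started at `v` first hits
the set `A` at time `n`, and does so at the point `u`. -/
def hitStep (A : Set (ℤ × ℤ)) : ℕ → (ℤ × ℤ) → (ℤ × ℤ) → ℝ
  | 0, v, u => if v = u ∧ v ∈ A then 1 else 0
  | n + 1, v, u => if v ∈ A then 0 else (1 / 4) * ∑ w ∈ nbrs v, hitStep A n w u

/-- Harmonic measure `Hm(v, u; A) = ℙ_v(S_{τ_A} = u)`. -/
def hm (v u : ℤ × ℤ) (A : Set (ℤ × ℤ)) : ℝ := ∑' n, hitStep A n v u

/-- `Hm(v, B; A) = ∑_{u ∈ B} Hm(v, u; A)`. -/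
def hmSet (v : ℤ × ℤ) (B A : Set (ℤ × ℤ)) : ℝ := ∑' u : B, hm v (↑u) A

/-! ### Centered Gaussian families and the discrete GFF -/

/-- `f` is a centered Gaussian family (over the indices in `S`) with covariance `K`:
every finite linear combination of the `f i`, `i ∈ S`, is a centered Gaussian variable whose
variance is the corresponding quadratic form of `K`. -/
def IsGaussFam {Ω ι : Type*} [MeasurableSpace Ω] (P : Measure Ω)
    (f : ι → Ω → ℝ) (K : ι → ι → ℝ) (S : Set ι) : Prop :=
  (∀ i, Measurable (f i)) ∧
  ∀ l : ι →₀ ℝ, ↑l.support ⊆ S →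
    P.map (fun ω => ∑ i ∈ l.support, l i * f i ω) =
      gaussianReal 0 (∑ i ∈ l.support, ∑ j ∈ l.support, l i * l j * K i j).toNNReal

/-- Covariance of the discrete GFF on `V_N` with Dirichlet boundary conditions:
`(1/4) G_{V_N}(u,v)`. -/
def gffCov (N : ℕ) (u v : ℤ × ℤ) : ℝ :=
  if u ∈ box N ∧ v ∈ box N then (1 / 4) * green N u v else 0

/-- `η` is a discrete Gaussian free field on `V_N` with Dirichlet boundary conditions. -/
def IsGFF {Ω : Type*} [MeasurableSpace Ω] (N : ℕ) (P : Measure Ω)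
    (η : ℤ × ℤ → Ω → ℝ) : Prop :=
  IsGaussFam P η (gffCov N) Set.univ

/-! ### Paths and chemical distances in lattice subgraphs -/

/-- `p` is a nearest-neighbour path of `n` steps from `u` to `v` staying in `H`. -/
def IsPath (H : Set (ℤ × ℤ)) (u v : ℤ × ℤ) (n : ℕ) (p : ℕ → ℤ × ℤ) : Prop :=
  p 0 = u ∧ p n = v ∧ (∀ i ≤ n, p i ∈ H) ∧ ∀ i < n, adj (p i) (p (i + 1))

/-- The chemical distance (graph distance) between `A` and `B` inside `H` is `≤ t`. -/
def ConnLe (H : Set (ℤ × ℤ)) (A B : Set (ℤ × ℤ)) (t : ℝ) : Prop :=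
  ∃ n : ℕ, (n : ℝ) ≤ t ∧ ∃ u ∈ A, ∃ v ∈ B, ∃ p, IsPath H u v n p

/-- The chemical distance (graph distance) between `A` and `B` inside `H` is `≥ t`
(in particular this holds when `A` and `B` are not connected inside `H`). -/
def DistGe (H : Set (ℤ × ℤ)) (A B : Set (ℤ × ℤ)) (t : ℝ) : Prop :=
  ∀ n : ℕ, ∀ u ∈ A, ∀ v ∈ B, ∀ p, IsPath H u v n p → t ≤ (n : ℝ)

/-! ### The Gaussian free field on the metric graph `G̃'_N` of the doubled graph `G'_N`.

Each edge `e` of `V_N` is replaced by two parallel edges: `e(1)` of conductance `1/8`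
(metric length 4) and `e(2)` of conductance `7/8` (metric length `4/7`).  A point on the
parallel copy `b ∈ {e(1), e(2)}` of the edge `(u,v)`, at metric distance `t` from `u`, is
recorded as `(u, v, b, t)`; the tag `b = true` denotes `e(1)`.  As in the paper, the field is
described by the discrete GFF at the vertices together with independent variance-2
Brownian-bridge fluctuations along each metric edge. -/

/-- Covariance of a variance-2 Brownian bridge of duration `T` (from `0` to `0`). -/
def bridgeCov (T s t : ℝ) : ℝ := 2 * (min s t - s * t / T)

/-- Metric length of the two parallel edges: `e(1)` (tag `true`) has length 4 and `e(2)`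
(tag `false`) has length `4/7`. -/
def edgeLen (b : Bool) : ℝ := if b then 4 else 4 / 7

/-- Index type for the joint family (vertex values ⊕ bridge fluctuations). -/
abbrev M2Idx : Type := (ℤ × ℤ) ⊕ ((ℤ × ℤ) × (ℤ × ℤ) × Bool × ℝ)

/-- Covariance of the joint family. -/
def m2Cov (N : ℕ) : M2Idx → M2Idx → ℝ
  | .inl u, .inl v => gffCov N u v
  | .inr ⟨u, v, b, s⟩, .inr ⟨u', v', b', t⟩ =>
      if b = b' then
        (if u = u' ∧ v = v' then bridgeCov (edgeLen b) s t
         else if u = v' ∧ v = u' then bridgeCov (edgeLen b) s (edgeLen b - t)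
         else 0)
      else 0
  | _, _ => 0

/-- The meaningful indices. -/
def m2Valid (N : ℕ) : Set M2Idx :=
  {i | match i with
       | .inl u => u ∈ box N
       | .inr ⟨u, v, b, t⟩ =>
           u ∈ box N ∧ v ∈ box N ∧ adj u v ∧ t ∈ Set.Icc (0 : ℝ) (edgeLen b)}

/-- The joint family of vertex values and bridge fluctuations. -/
def m2fam {Ω : Type*} (η : ℤ × ℤ → Ω → ℝ)
    (brg : (ℤ × ℤ) → (ℤ × ℤ) → Bool → ℝ → Ω → ℝ) : M2Idx → Ω → ℝ
  | .inl u => η u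
  | .inr ⟨u, v, b, t⟩ => brg u v b t

/-- The value `η̃'_{N,·}` of the metric-graph field at the point of the copy `b` of the edge
`(u,v)` at metric distance `t` from `u`. -/
def mval2 {Ω : Type*} (η : ℤ × ℤ → Ω → ℝ) (brg : (ℤ × ℤ) → (ℤ × ℤ) → Bool → ℝ → Ω → ℝ)
    (u v : ℤ × ℤ) (b : Bool) (t : ℝ) (ω : Ω) : ℝ :=
  (1 - t / edgeLen b) * η u ω + (t / edgeLen b) * η v ω + brg u v b t ω

/-- `(η, brg)` is a Gaussian free field on the metric graph `G̃'_N`. -/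
def IsMetricGFF2 {Ω : Type*} [MeasurableSpace Ω] (N : ℕ) (P : Measure Ω)
    (η : ℤ × ℤ → Ω → ℝ) (brg : (ℤ × ℤ) → (ℤ × ℤ) → Bool → ℝ → Ω → ℝ) : Prop :=
  IsGaussFam P (m2fam η brg) (m2Cov N) (m2Valid N) ∧
  (∀ u v b ω, brg u v b 0 ω = 0) ∧
  (∀ u v b ω, brg u v b (edgeLen b) ω = 0) ∧
  (∀ u v b t ω, brg u v b t ω = brg v u b (edgeLen b - t) ω) ∧
  (∀ u v b ω, ContinuousOn (fun t => brg u v b t ω) (Set.Icc 0 (edgeLen b)))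

/-! ### Statement 13: the entropic-repulsion bound for the conditioned metric-graph GFF.

`Π_N`-discretization points of `V_N ∪ E_N(1)`: the point at lattice position `j/N³`
(metric distance `4j/N³` on `e(1)`) along the edge `(u,u')` is recorded as `(u, u', j)`,
`0 ≤ j ≤ N³`. -/

/-- A discretization point of `Π_N`. -/
abbrev PPt : Type := (ℤ × ℤ) × (ℤ × ℤ) × ℕ

/-- The point `(u, u', j)` is a genuine point of `Π_N`. -/
def pValid (N : ℕ) (q : PPt) : Prop :=
  q.1 ∈ box N ∧ q.2.1 ∈ box N ∧ adj q.1 q.2.1 ∧ q.2.2 ≤ N ^ 3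

/-- The value of the metric-graph field `η̃'_N` at the discretization point `(u, u', j)`. -/
def pval {Ω : Type*} (N : ℕ) (η : ℤ × ℤ → Ω → ℝ)
    (brg : (ℤ × ℤ) → (ℤ × ℤ) → Bool → ℝ → Ω → ℝ) (q : PPt) (ω : Ω) : ℝ :=
  mval2 η brg q.1 q.2.1 true (4 * (q.2.2 : ℝ) / (N : ℝ) ^ 3) ω

/-- The point of `Π_N ∖ G̃_{αN}` recorded by `(u, u', j)` lies outside the metric graph over
`V_{αN}`. -/
def outsideAlpha (α : ℝ) (N : ℕ) (q : PPt) : Prop :=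
  ¬(q.1 ∈ boxR (α * N) ∧ q.2.1 ∈ boxR (α * N))

/-- The event `H₊ ∩ H₋`: the field exceeds `λ + 1/N` on all of `I^{>λ}_k` and is below
`-λ - 1/N` on all of `I^{<-λ}_k`. -/
def eventH {Ω : Type*} (N : ℕ) (η : ℤ × ℤ → Ω → ℝ)
    (brg : (ℤ × ℤ) → (ℤ × ℤ) → Bool → ℝ → Ω → ℝ) (lam : ℝ) (Ip Im : Finset PPt) :
    Set Ω :=
  {ω | (∀ q ∈ Ip, lam + 1 / N < pval N η brg q ω) ∧
       ∀ q ∈ Im, pval N η brg q ω < -(lam + 1 / N)}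

/-- The event that the field values on `B₀ ∪ B^{=λ}_k ∪ B^{=-λ}_k` lie in the prescribed
ranges (`|·| ≤ λ + 1/N` on `B₀`; in `(λ, λ + 1/N]` on `B^{=λ}_k`; in `[-λ - 1/N, -λ)` on
`B^{=-λ}_k`). -/
def eventRng {Ω : Type*} (N : ℕ) (η : ℤ × ℤ → Ω → ℝ)
    (brg : (ℤ × ℤ) → (ℤ × ℤ) → Bool → ℝ → Ω → ℝ) (lam : ℝ) (B0 : Finset (ℤ × ℤ))
    (Bp Bm : Finset PPt) : Set Ω :=
  {ω | (∀ x ∈ B0, |η x ω| ≤ lam + 1 / N) ∧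
       (∀ q ∈ Bp, lam < pval N η brg q ω ∧ pval N η brg q ω ≤ lam + 1 / N) ∧
       ∀ q ∈ Bm, -(lam + 1 / N) ≤ pval N η brg q ω ∧ pval N η brg q ω < -lam}

/-- The σ-algebra generated by the field values on `B₀ ∪ B^{=λ}_k ∪ B^{=-λ}_k` (conditioning
on these values, i.e. on `H_=`, is conditioning on this σ-algebra). -/
def condSigma {Ω : Type*} [MeasurableSpace Ω] (N : ℕ) (η : ℤ × ℤ → Ω → ℝ)
    (brg : (ℤ × ℤ) → (ℤ × ℤ) → Bool → ℝ → Ω → ℝ) (B0 : Finset (ℤ × ℤ))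
    (Bp Bm : Finset PPt) : MeasurableSpace Ω :=
  MeasurableSpace.comap
    (fun ω => ((fun x : {x // x ∈ B0} => η x.1 ω),
               (fun q : {q // q ∈ Bp ∪ Bm} => pval N η brg q.1 ω)))
    inferInstance

/-! ### Statement 15: the conditional-variance bound for the observable `X₃`.

Brownian motion on `G̃'_N`, observed on the vertices together with the `Π_N`-discretization
points of the `e(1)`-edges, is the random walk on the electrical network in which each copy
`e(2)` is a single conductance `7/8` between its endpoints and each copy `e(1)` is divided by
its `N³ - 1` interior discretization points into `N³` segments of conductance `N³/8` each.
Its harmonic measure `H̃m'` on target sets made of such points is the harmonic measure of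
this network random walk. -/

/-- Strict lexicographic order on `ℤ²` (used to pick a canonical orientation of each edge). -/
def lexLt (a b : ℤ × ℤ) : Prop := a.1 < b.1 ∨ (a.1 = b.1 ∧ a.2 < b.2)

/-- Nodes of the subdivided network: lattice vertices, or interior discretization points of
`e(1)`-edges (canonically oriented). -/
abbrev NIdx : Type := (ℤ × ℤ) ⊕ PPt

/-- The node representing the discretization point `j/N³` along the edge `(u,u')`. -/
def gridNode (N : ℕ) (u u' : ℤ × ℤ) (j : ℕ) : NIdx :=
  if j = 0 then .inl u
  else if j = N ^ 3 then .inl u'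
  else if lexLt u u' then .inr (u, u', j)
  else .inr (u', u, N ^ 3 - j)

/-- The node representing a discretization point of `Π_N`. -/
def nodeOf (N : ℕ) (q : PPt) : NIdx := gridNode N q.1 q.2.1 q.2.2

/-- The neighbours of a node in the subdivided network. -/
def nodeNbrs (N : ℕ) : NIdx → Finset NIdx
  | .inl u => ((nbrs u).image Sum.inl) ∪ ((nbrs u).image fun u' => gridNode N u u' 1)
  | .inr q => {gridNode N q.1 q.2.1 (q.2.2 - 1), gridNode N q.1 q.2.1 (q.2.2 + 1)}

/-- Conductances of the subdivided network: `7/8` between neighbouring vertices (the `e(2)`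
edge; plus the whole of `e(1)` in the degenerate case `N³ = 1`), and `N³/8` between
consecutive discretization points of an `e(1)` edge. -/
def netCond (N : ℕ) : NIdx → NIdx → ℝ
  | .inl u, .inl u' =>
      if u ∈ box N ∧ u' ∈ box N ∧ adj u u' then
        (7 / 8 + if N ^ 3 = 1 then 1 / 8 else 0) else 0
  | .inl u, .inr ⟨a, b, j⟩ =>
      if a ∈ box N ∧ b ∈ box N ∧ adj a b ∧ lexLt a b ∧ 0 < j ∧ j < N ^ 3 ∧
          ((u = a ∧ j = 1) ∨ (u = b ∧ j + 1 = N ^ 3)) then (N : ℝ) ^ 3 / 8 else 0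
  | .inr ⟨a, b, j⟩, .inl u =>
      if a ∈ box N ∧ b ∈ box N ∧ adj a b ∧ lexLt a b ∧ 0 < j ∧ j < N ^ 3 ∧
          ((u = a ∧ j = 1) ∨ (u = b ∧ j + 1 = N ^ 3)) then (N : ℝ) ^ 3 / 8 else 0
  | .inr ⟨a, b, j⟩, .inr ⟨a', b', j'⟩ =>
      if a = a' ∧ b = b' ∧ a ∈ box N ∧ b ∈ box N ∧ adj a b ∧ lexLt a b ∧
          0 < j ∧ j < N ^ 3 ∧ 0 < j' ∧ j' < N ^ 3 ∧ (j + 1 = j' ∨ j' + 1 = j)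
        then (N : ℝ) ^ 3 / 8 else 0

/-- `netStep N A n x y`: probability that the network random walk started at `x` first hits
the target set `A` at time `n` and does so at the node `y`. -/
def netStep (N : ℕ) (A : Set NIdx) : ℕ → NIdx → NIdx → ℝ
  | 0, x, y => if x = y ∧ x ∈ A then 1 else 0
  | n + 1, x, y =>
      if x ∈ A then 0
      else ∑ z ∈ nodeNbrs N x,
        (netCond N x z / ∑ z' ∈ nodeNbrs N x, netCond N x z') * netStep N A n z y

/-- The harmonic measure `H̃m'(x, y; A)` of Brownian motion on `G̃'_N` (observed on the
subdivided network) at the node `y`, started from `x`, with target set `A`. -/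
def hmNet (N : ℕ) (A : Set NIdx) (x y : NIdx) : ℝ := ∑' n, netStep N A n x y

/-- The nodes of `Explored_k ∪ ∂V_N`. -/
def targetNodes (N : ℕ) (Ip Im Bp Bm : Finset PPt) (B0 : Finset (ℤ × ℤ)) : Finset NIdx :=
  ((Ip ∪ Im ∪ Bp ∪ Bm).image (nodeOf N)) ∪ (B0.image Sum.inl) ∪ ((bdry N).image Sum.inl)

/-- The observable
`X₃ = |∂V_{(1+β)N/2}|⁻¹ ∑_{u ∈ ∂V_{(1+β)N/2}} ∑_{v ∈ J₃} H̃m'(u, v; Explored_k ∪ ∂V_N) η̃'_{N,v}`. -/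
def X3 {Ω : Type*} (N : ℕ) (β : ℝ) (Ip Im Bp Bm : Finset PPt) (B0 J3 : Finset (ℤ × ℤ))
    (η : ℤ × ℤ → Ω → ℝ) (ω : Ω) : ℝ :=
  (((bdryR ((1 + β) * N / 2)).card : ℝ))⁻¹ *
    ∑ u ∈ bdryR ((1 + β) * N / 2), ∑ v ∈ J3,
      hmNet N (↑(targetNodes N Ip Im Bp Bm B0)) (Sum.inl u) (Sum.inl v) * η v ω


theorem bm_compact (A B C : Set ℝ) (hA : IsCompact A) (hB : IsCompact B)
    (hAn : A.Nonempty) (hBn : B.Nonempty) (hC : ∀ a ∈ A, ∀ b ∈ B, (a + b) / 2 ∈ C) :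
    volume A + volume B ≤ 2 * volume C := by
  set a := sSup A with ha
  set b := sInf B with hb
  have haA : a ∈ A := hA.sSup_mem hAn
  have hbB : b ∈ B := hB.sInf_mem hBn
  set P : Set ℝ := (fun x => x + (-b)) ⁻¹' A
  set Q : Set ℝ := (fun x => x + (-a)) ⁻¹' B
  have hP : volume P = volume A := measure_preimage_add_right _ _ _
  have hQ : volume Q = volume B := measure_preimage_add_right _ _ _
  have hQm : MeasurableSet Q := hB.measurableSet.preimage (by fun_prop)
  have hsub : P ∪ Q ⊆ (fun x => (2⁻¹ : ℝ) * x) ⁻¹' C := by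
    rintro x (hx | hx)
    · have := hC _ hx _ hbB
      simp only [mem_preimage]; convert this using 1; ring
    · have := hC _ haA _ hx
      simp only [mem_preimage]; convert this using 1; ring
  have hint : volume (P ∩ Q) = 0 := by
    refine measure_mono_null (t := {a + b}) ?_ (by simp)
    rintro x ⟨hx, hx'⟩
    have h1 : x + (-b) ≤ a := le_csSup hA.bddAbove hx
    have h2 : b ≤ x + (-a) := csInf_le hB.bddBelow hx'
    simp only [mem_singleton_iff]; linarith
  have h := measure_union_add_inter (μ := volume) P hQm
  rw [hint, add_zero, hP, hQ] at h
  rw [← h]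
  calc volume (P ∪ Q) ≤ volume ((fun x => (2⁻¹ : ℝ) * x) ⁻¹' C) := measure_mono hsub
    _ = 2 * volume C := by
      rw [Real.volume_preimage_mul_left (by norm_num)]
      simp

theorem bm1 (A B C : Set ℝ) (hA : MeasurableSet A) (hB : MeasurableSet B)
    (hAn : A.Nonempty) (hBn : B.Nonempty) (hC : ∀ a ∈ A, ∀ b ∈ B, (a + b) / 2 ∈ C) :
    volume A + volume B ≤ 2 * volume C := by
  obtain ⟨a, ha⟩ := hAn
  obtain ⟨b, hb⟩ := hBn
  have key : ∀ K ⊆ A, IsCompact K → ∀ L ⊆ B, IsCompact L →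
      volume K + volume L ≤ 2 * volume C := by
    intro K hK hKc L hL hLc
    have h1 := bm_compact (insert a K) (insert b L) C (hKc.insert a) (hLc.insert b)
      (insert_nonempty _ _) (insert_nonempty _ _) (by
        intro x hx y hy
        exact hC x (insert_subset ha hK hx) y (insert_subset hb hL hy))
    refine le_trans ?_ h1
    gcongr <;> exact subset_insert _ _
  have h2 : ∀ K ⊆ A, IsCompact K → volume K + volume B ≤ 2 * volume C := by
    intro K hK hKc
    rw [hB.measure_eq_iSup_isCompact]
    have hfin : volume K ≠ ⊤ := hKc.measure_lt_top.ne
    rw [add_comm]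
    apply add_le_of_le_tsub_right_of_le
    · exact le_trans le_self_add (key K hK hKc ∅ (empty_subset _) isCompact_empty)
    · refine iSup₂_le fun L hL => iSup_le fun hLc => ?_
      apply ENNReal.le_sub_of_add_le_left hfin
      exact key K hK hKc L hL hLc
  by_cases hBt : volume B = ⊤
  · have := h2 ∅ (empty_subset _) isCompact_empty
    simp [hBt] at this
    simp [this]
  · apply add_le_of_le_tsub_right_of_le
    · exact le_trans le_add_self (h2 ∅ (empty_subset _) isCompact_empty)
    · rw [hA.measure_eq_iSup_isCompact]
      refine iSup₂_le fun L hL => iSup_le fun hLc => ?_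
      apply ENNReal.le_sub_of_add_le_right hBt
      exact h2 L hL hLc

theorem ennreal_amgm (F G H : ENNReal) (h : F + G ≤ 2 * H) : F * G ≤ H ^ 2 := by
  by_cases hH : H = ⊤
  · simp [hH]
  have hF : F ≠ ⊤ := by
    rintro rfl
    simp at h
    exact absurd h (ENNReal.mul_ne_top (by simp) hH)
  have hG : G ≠ ⊤ := by
    rintro rfl
    simp at h
    exact absurd h (ENNReal.mul_ne_top (by simp) hH)
  lift F to NNReal using hF
  lift G to NNReal using hG
  lift H to NNReal using hH
  norm_cast at *
  have : (F : ℝ) + G ≤ 2 * H := by exact_mod_cast h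
  have h2 : (F : ℝ) * G ≤ H ^ 2 := by
    nlinarith [sq_nonneg ((F : ℝ) - G), F.2, G.2, H.2, NNReal.coe_nonneg F, NNReal.coe_nonneg G]
  exact_mod_cast h2

theorem pl1_norm (f g h : ℝ → ℝ) (hf : Measurable f) (hg : Measurable g) (hh : Measurable h)
    (f0 : ∀ x, 0 ≤ f x) (g0 : ∀ x, 0 ≤ g x) (h0 : ∀ x, 0 ≤ h x)
    (f1 : ∀ x, f x ≤ 1) (g1 : ∀ x, g x ≤ 1)
    (f2 : ∀ t < 1, ∃ x, t < f x) (g2 : ∀ t < 1, ∃ x, t < g x)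
    (H : ∀ x y, f x * g y ≤ h ((x + y) / 2) ^ 2) :
    (∫⁻ x, ENNReal.ofReal (f x)) * (∫⁻ x, ENNReal.ofReal (g x)) ≤
      (∫⁻ x, ENNReal.ofReal (h x)) ^ 2 := by
  apply ennreal_amgm
  rw [lintegral_eq_lintegral_meas_lt _ (.of_forall f0) hf.aemeasurable,
    lintegral_eq_lintegral_meas_lt _ (.of_forall g0) hg.aemeasurable,
    lintegral_eq_lintegral_meas_lt _ (.of_forall h0) hh.aemeasurable]
  have hmeas : ∀ (f : ℝ → ℝ), Measurable (fun t : ℝ => volume {a : ℝ | t < f a}) := by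
    intro f
    apply Antitone.measurable
    intro s t hst
    exact measure_mono fun x hx => lt_of_le_of_lt hst hx
  rw [← lintegral_add_left (hmeas f), ← lintegral_const_mul _ (hmeas h)]
  apply setLIntegral_mono' measurableSet_Ioi
  intro t ht
  simp only [mem_Ioi] at ht
  by_cases h1 : t < 1
  · apply bm1
    · exact measurableSet_lt measurable_const hf
    · exact measurableSet_lt measurable_const hg
    · exact f2 t h1
    · exact g2 t h1
    · intro x hx y hy
      simp only [mem_ofPred_eq] at *
      have := H x y
      have h3 : t * t < f x * g y := mul_lt_mul'' hx hy ht.le ht.le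
      nlinarith [h0 ((x + y) / 2)]
  · have e1 : {a : ℝ | t < f a} = ∅ := by
      ext x; simp only [mem_ofPred_eq, mem_empty_iff_false, iff_false, not_lt]
      exact (f1 x).trans (not_lt.1 h1)
    have e2 : {a : ℝ | t < g a} = ∅ := by
      ext x; simp only [mem_ofPred_eq, mem_empty_iff_false, iff_false, not_lt]
      exact (g1 x).trans (not_lt.1 h1)
    simp [e1, e2]

theorem pl1_bdd (f g h : ℝ → ℝ) (hf : Measurable f) (hg : Measurable g) (hh : Measurable h)
    (f0 : ∀ x, 0 ≤ f x) (g0 : ∀ x, 0 ≤ g x) (h0 : ∀ x, 0 ≤ h x) (M : ℝ)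
    (f1 : ∀ x, f x ≤ M) (g1 : ∀ x, g x ≤ M)
    (H : ∀ x y, f x * g y ≤ h ((x + y) / 2) ^ 2) :
    (∫⁻ x, ENNReal.ofReal (f x)) * (∫⁻ x, ENNReal.ofReal (g x)) ≤
      (∫⁻ x, ENNReal.ofReal (h x)) ^ 2 := by
  have bf : BddAbove (range f) := ⟨M, by rintro _ ⟨x, rfl⟩; exact f1 x⟩
  have bg : BddAbove (range g) := ⟨M, by rintro _ ⟨x, rfl⟩; exact g1 x⟩
  set A := sSup (range f) with hA
  set B := sSup (range g) with hB
  have fA : ∀ x, f x ≤ A := fun x => le_csSup bf ⟨x, rfl⟩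
  have gB : ∀ x, g x ≤ B := fun x => le_csSup bg ⟨x, rfl⟩
  rcases (le_trans (f0 0) (fA 0)).eq_or_lt with hA0 | hA0
  · have : ∀ x, f x = 0 := fun x => le_antisymm (hA0 ▸ fA x) (f0 x)
    simp [this]
  rcases (le_trans (g0 0) (gB 0)).eq_or_lt with hB0 | hB0
  · have : ∀ x, g x = 0 := fun x => le_antisymm (hB0 ▸ gB x) (g0 x)
    simp [this]
  have hAB : 0 < √(A * B) := Real.sqrt_pos.2 (by positivity)
  have key := pl1_norm (fun x => f x / A) (fun x => g x / B) (fun x => h x / √(A * B))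
    (by fun_prop) (by fun_prop) (by fun_prop)
    (fun x => div_nonneg (f0 x) hA0.le) (fun x => div_nonneg (g0 x) hB0.le)
    (fun x => div_nonneg (h0 x) hAB.le)
    (fun x => (div_le_one hA0).2 (fA x)) (fun x => (div_le_one hB0).2 (gB x))
    (fun t ht => by
      obtain ⟨_, ⟨x, rfl⟩, hx⟩ := exists_lt_of_lt_csSup (range_nonempty f)
        (show t * A < sSup (range f) by rw [← hA]; nlinarith)
      exact ⟨x, (lt_div_iff₀ hA0).2 hx⟩)
    (fun t ht => by
      obtain ⟨_, ⟨x, rfl⟩, hx⟩ := exists_lt_of_lt_csSup (range_nonempty g)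
        (show t * B < sSup (range g) by rw [← hB]; nlinarith)
      exact ⟨x, (lt_div_iff₀ hB0).2 hx⟩)
    (fun x y => by
      rw [div_pow, Real.sq_sqrt (by positivity), div_mul_div_comm]
      gcongr
      exact H x y)
  have sc : ∀ (f : ℝ → ℝ) (c : ℝ), 0 < c → Measurable f →
      ∫⁻ x, ENNReal.ofReal (f x) = ENNReal.ofReal c * ∫⁻ x, ENNReal.ofReal (f x / c) := by
    intro f c hc hf
    rw [← lintegral_const_mul _ (by fun_prop)]
    congr 1; ext x
    rw [← ENNReal.ofReal_mul hc.le]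
    congr 1; field_simp
  rw [sc f A hA0 hf, sc g B hB0 hg, sc h _ hAB hh, mul_pow, mul_mul_mul_comm]
  rw [← ENNReal.ofReal_mul hA0.le, ← ENNReal.ofReal_pow hAB.le, Real.sq_sqrt (by positivity)]
  gcongr

theorem pl1 (f g h : ℝ → ENNReal) (hf : Measurable f) (hg : Measurable g) (hh : Measurable h)
    (H : ∀ x y, f x * g y ≤ h ((x + y) / 2) ^ 2) :
    (∫⁻ x, f x) * (∫⁻ x, g x) ≤ (∫⁻ x, h x) ^ 2 := by
  have hsup : ∀ (f : ℝ → ENNReal), Measurable f →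
      ∫⁻ x, f x = ⨆ k : ℕ, ∫⁻ x, min (f x) k := by
    intro f hf
    rw [← lintegral_iSup (fun k => by fun_prop)]
    · congr 1; ext x
      rw [← inf_iSup_eq, ENNReal.iSup_natCast]; simp
    · intro i j hij x
      exact min_le_min le_rfl (by exact_mod_cast hij)
  have hb : ∀ k : ℕ, (∫⁻ x, min (f x) k) * (∫⁻ x, min (g x) k) ≤ (∫⁻ x, h x) ^ 2 := by
    intro k
    have hnt : ∀ a : ENNReal, min a k ≠ ⊤ := fun a =>
      ne_top_of_le_ne_top (ENNReal.natCast_ne_top k) (min_le_right _ _)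
    have := pl1_bdd (fun x => (min (f x) k).toReal) (fun x => (min (g x) k).toReal)
      (fun x => (min (h x) k).toReal) (by fun_prop) (by fun_prop) (by fun_prop)
      (fun _ => ENNReal.toReal_nonneg) (fun _ => ENNReal.toReal_nonneg)
      (fun _ => ENNReal.toReal_nonneg) k
      (fun x => by
        simpa using ENNReal.toReal_mono (ENNReal.natCast_ne_top k) (min_le_right (f x) k))
      (fun x => by
        simpa using ENNReal.toReal_mono (ENNReal.natCast_ne_top k) (min_le_right (g x) k))
      (fun x y => by
        rw [← ENNReal.toReal_mul, ← ENNReal.toReal_pow]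
        apply ENNReal.toReal_mono (ENNReal.pow_ne_top (hnt _))
        rcases le_total (h ((x + y) / 2)) k with hk | hk
        · rw [min_eq_left hk]
          refine le_trans ?_ (H x y)
          gcongr <;> exact min_le_left _ _
        · rw [min_eq_right hk, sq]
          gcongr <;> exact min_le_right _ _)
    simp only [ENNReal.ofReal_toReal (hnt _)] at this
    refine this.trans ?_
    gcongr
    exact min_le_left _ _
  rw [hsup f hf, hsup g hg, ENNReal.iSup_mul]
  refine iSup_le fun i => ?_
  rw [ENNReal.mul_iSup]
  refine iSup_le fun j => ?_
  refine le_trans ?_ (hb (max i j))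
  gcongr <;> simp


theorem gauss_pl1 (f g h : ℝ → ENNReal) (hf : Measurable f) (hg : Measurable g)
    (hh : Measurable h)
    (H : ∀ x y, f x * g y ≤ ENNReal.ofReal (Real.exp ((x - y) ^ 2 / 4)) * h ((x + y) / 2) ^ 2) :
    (∫⁻ x, f x ∂(gaussianReal 0 1)) * (∫⁻ x, g x ∂(gaussianReal 0 1)) ≤
      (∫⁻ x, h x ∂(gaussianReal 0 1)) ^ 2 := by
  have hp : Measurable (gaussianPDF 0 1) := measurable_gaussianPDF 0 1
  have e : ∀ f : ℝ → ENNReal, Measurable f → ∫⁻ x, f x ∂(gaussianReal 0 1) =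
      ∫⁻ x, gaussianPDF 0 1 x * f x := by
    intro f hf
    rw [gaussianReal_of_var_ne_zero 0 one_ne_zero, lintegral_withDensity_eq_lintegral_mul _ hp hf]
    rfl
  rw [e f hf, e g hg, e h hh]
  apply pl1 _ _ _ (hp.mul hf) (hp.mul hg) (hp.mul hh)
  intro x y
  have h1 : gaussianPDF 0 1 x * gaussianPDF 0 1 y *
      ENNReal.ofReal (Real.exp ((x - y) ^ 2 / 4)) = gaussianPDF 0 1 ((x + y) / 2) ^ 2 := by
    simp only [gaussianPDF, gaussianPDFReal]
    rw [← ENNReal.ofReal_mul (by positivity), ← ENNReal.ofReal_mul (by positivity),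
      ← ENNReal.ofReal_pow (by positivity)]
    congr 1
    rw [mul_mul_mul_comm, mul_assoc, ← Real.exp_add, ← Real.exp_add, mul_pow, ← Real.exp_nat_mul,
      ← sq]
    congr 2
    simp
    ring
  calc gaussianPDF 0 1 x * f x * (gaussianPDF 0 1 y * g y)
      = gaussianPDF 0 1 x * gaussianPDF 0 1 y * (f x * g y) := by ring
    _ ≤ gaussianPDF 0 1 x * gaussianPDF 0 1 y *
        (ENNReal.ofReal (Real.exp ((x - y) ^ 2 / 4)) * h ((x + y) / 2) ^ 2) := by
        exact mul_le_mul' le_rfl (H x y)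
    _ = (gaussianPDF 0 1 ((x + y) / 2) * h ((x + y) / 2)) ^ 2 := by
        rw [← mul_assoc, h1]; ring

theorem gauss_pln (n : ℕ) : ∀ (f g h : (Fin n → ℝ) → ENNReal), Measurable f → Measurable g →
    Measurable h →
    (∀ x y, f x * g y ≤ ENNReal.ofReal (Real.exp ((∑ i, (x i - y i) ^ 2) / 4)) *
      h (fun i => (x i + y i) / 2) ^ 2) →
    (∫⁻ x, f x ∂(Measure.pi fun _ => gaussianReal 0 1)) *
      (∫⁻ x, g x ∂(Measure.pi fun _ => gaussianReal 0 1)) ≤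
      (∫⁻ x, h x ∂(Measure.pi fun _ => gaussianReal 0 1)) ^ 2 := by
  induction n with
  | zero =>
    intro f g h hf hg hh H
    simp only [lintegral_unique]
    generalize (@default (Fin 0 → ℝ) Unique.instInhabited) = d
    have := H d d
    have e1 : (fun i => (d i + d i) / 2) =
      d := Subsingleton.elim _ _
    rw [e1, Finset.univ_eq_empty, Finset.sum_empty] at this
    simpa only [zero_div, Real.exp_zero, ENNReal.ofReal_one, one_mul, measure_univ, mul_one]
      using this
  | succ n ih =>
    intro f g h hf hg hh H
    have mp := measurePreserving_piFinSuccAbove (fun _ : Fin (n + 1) => gaussianReal 0 1) 0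
    have cm : Measurable (fun p : ℝ × (Fin n → ℝ) => (Fin.cons p.1 p.2 : Fin (n + 1) → ℝ)) := by
      rw [measurable_pi_iff]
      intro i
      refine Fin.cases ?_ (fun j => ?_) i
      · simpa using measurable_fst
      · simp only [Fin.cons_succ]
        fun_prop
    have e : ∀ f : (Fin (n + 1) → ℝ) → ENNReal, Measurable f →
        ∫⁻ x, f x ∂(Measure.pi fun _ => gaussianReal 0 1) =
        ∫⁻ x, ∫⁻ v, f (Fin.cons x v) ∂(Measure.pi fun _ => gaussianReal 0 1)
          ∂(gaussianReal 0 1) := by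
      intro f hf
      rw [← lintegral_prod (fun p : ℝ × (Fin n → ℝ) => f (Fin.cons p.1 p.2))
        (hf.comp cm).aemeasurable]
      rw [← mp.map_eq, lintegral_map (f := fun p : ℝ × (Fin n → ℝ) => f (Fin.cons p.1 p.2)) (hf.comp cm)
        mp.measurable]
      congr 1; ext x
      congr 1
      ext i
      refine Fin.cases ?_ (fun j => ?_) i
      · simp [MeasurableEquiv.piFinSuccAbove]
      · simp [MeasurableEquiv.piFinSuccAbove, Fin.tail]
    rw [e f hf, e g hg, e h hh]
    have mm : ∀ f : (Fin (n + 1) → ℝ) → ENNReal, Measurable f →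
        Measurable fun x => ∫⁻ v, f (Fin.cons x v) ∂(Measure.pi fun _ => gaussianReal 0 1) :=
      fun f hf => (hf.comp cm).lintegral_prod_right'
    have ms : ∀ (f : (Fin (n + 1) → ℝ) → ENNReal) (x : ℝ), Measurable f →
        Measurable fun v : Fin n → ℝ => f (Fin.cons x v) :=
      fun f x hf => (hf.comp cm).comp measurable_prodMk_left
    apply gauss_pl1 _ _ _ (mm f hf) (mm g hg) (mm h hh)
    intro x y
    set c : ENNReal := ENNReal.ofReal (Real.exp ((x - y) ^ 2 / 4 / 2)) with hc
    have hc2 : c ^ 2 = ENNReal.ofReal (Real.exp ((x - y) ^ 2 / 4)) := by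
      rw [hc, ← ENNReal.ofReal_pow (by positivity), ← Real.exp_nat_mul]
      congr 2; push_cast; ring
    rw [← hc2, ← mul_pow, ← lintegral_const_mul _ (ms h _ hh)]
    apply ih _ _ _ (ms f x hf) (ms g y hg) ((ms h _ hh).const_mul c)
    intro v w
    refine (H _ _).trans (le_of_eq ?_)
    rw [mul_pow, hc2, ← mul_assoc, ← ENNReal.ofReal_mul (by positivity), ← Real.exp_add]
    congr 3
    · congr 1
      rw [Fin.sum_univ_succ]
      simp; ring
    · congr 1; ext i
      refine Fin.cases ?_ (fun j => ?_) i <;> simp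

theorem gauss_exp (n : ℕ) (K : Set (Fin n → ℝ)) (hK : MeasurableSet K)
    (hc : ∀ x ∈ K, ∀ y ∈ K, (fun i => (x i + y i) / 2) ∈ K) (ξ : Fin n → ℝ) (s : ℝ)
    (hs : ∑ i, ξ i ^ 2 ≤ s) :
    (∫⁻ x in K, ENNReal.ofReal (Real.exp (∑ i, x i * ξ i)) ∂(Measure.pi fun _ => gaussianReal 0 1)) *
      (∫⁻ x in K, ENNReal.ofReal (Real.exp (-∑ i, x i * ξ i))
        ∂(Measure.pi fun _ => gaussianReal 0 1)) ≤
      ENNReal.ofReal (Real.exp s) * (Measure.pi (fun _ : Fin n => gaussianReal 0 1) K) ^ 2 := by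
  have hr : ENNReal.ofReal (Real.exp s) * (Measure.pi (fun _ : Fin n => gaussianReal 0 1) K) ^ 2 =
      (∫⁻ x, K.indicator (fun _ => ENNReal.ofReal (Real.exp (s / 2))) x
        ∂(Measure.pi fun _ => gaussianReal 0 1)) ^ 2 := by
    rw [lintegral_indicator_const hK, mul_pow, ← ENNReal.ofReal_pow (by positivity),
      ← Real.exp_nat_mul]
    congr 3; push_cast; ring
  rw [hr, ← lintegral_indicator hK, ← lintegral_indicator hK]
  apply gauss_pln
  · exact Measurable.indicator (by fun_prop) hK
  · exact Measurable.indicator (by fun_prop) hK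
  · exact Measurable.indicator (by fun_prop) hK
  intro x y
  by_cases hx : x ∈ K
  swap
  · simp [hx]
  by_cases hy : y ∈ K
  swap
  · simp [hy]
  rw [indicator_of_mem hx, indicator_of_mem hy, indicator_of_mem (hc x hx y hy),
    ← ENNReal.ofReal_mul (by positivity), ← ENNReal.ofReal_pow (by positivity),
    ← ENNReal.ofReal_mul (by positivity), ← Real.exp_add, ← Real.exp_nat_mul, ← Real.exp_add]
  apply ENNReal.ofReal_le_ofReal
  apply Real.exp_le_exp.2
  have : ∑ i, (x i - y i) * ξ i ≤ ∑ i, ((x i - y i) ^ 2 / 4 + ξ i ^ 2) := by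
    apply Finset.sum_le_sum
    intro i _
    nlinarith [sq_nonneg ((x i - y i) / 2 - ξ i)]
  simp only [sub_mul, Finset.sum_sub_distrib, Finset.sum_add_distrib, ← Finset.sum_div] at this
  push_cast
  linarith

theorem var_from_exp {Ω : Type*} [MeasurableSpace Ω] (P : Measure Ω) [IsProbabilityMeasure P]
    (X : Ω → ℝ) (K : Set Ω) (hK : MeasurableSet K) (h2 : MemLp X 2 P)
    (h3 : Integrable (fun ω => Real.exp (X ω)) P)
    (h4 : Integrable (fun ω => Real.exp (-X ω)) P) (c : ℝ)
    (h : (∫ ω in K, Real.exp (X ω) ∂P) * (∫ ω in K, Real.exp (-X ω) ∂P) ≤ c * P.real K ^ 2) :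
    (∫ ω in K, X ω ^ 2 ∂P) * P.real K - (∫ ω in K, X ω ∂P) ^ 2 ≤ 2 * (c - 1) * P.real K ^ 2 := by
  set p := P.real K with hp
  have i1 : Integrable X (P.restrict K) := (h2.integrable (by norm_num)).restrict
  have i2 : Integrable (fun ω => X ω ^ 2) (P.restrict K) := h2.integrable_sq.restrict
  rcases (measureReal_nonneg : 0 ≤ P.real K).eq_or_lt with h0 | h0
  · have : P.restrict K = 0 := by
      rw [Measure.restrict_eq_zero]
      exact (measureReal_eq_zero_iff).1 h0.symm
    simp [this, hp, ← h0]
  rw [← hp] at h0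
  set S := ∫ ω in K, X ω ∂P
  set m := S / p with hm
  have e1 : (∫ ω in K, Real.exp (X ω - m) ∂P) = Real.exp (-m) * ∫ ω in K, Real.exp (X ω) ∂P := by
    rw [← integral_const_mul]; congr 1; ext ω; rw [← Real.exp_add]; congr 1; ring
  have e2 : (∫ ω in K, Real.exp (-(X ω - m)) ∂P) =
      Real.exp m * ∫ ω in K, Real.exp (-X ω) ∂P := by
    rw [← integral_const_mul]; congr 1; ext ω; rw [← Real.exp_add]; congr 1; ring
  have j1 : Integrable (fun ω => Real.exp (X ω - m)) (P.restrict K) := by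
    have := (h3.restrict (s := K)).const_mul (Real.exp (-m))
    refine this.congr (.of_forall fun ω => ?_)
    simp only; rw [← Real.exp_add]; congr 1; ring
  have j2 : Integrable (fun ω => Real.exp (-(X ω - m))) (P.restrict K) := by
    have := (h4.restrict (s := K)).const_mul (Real.exp m)
    refine this.congr (.of_forall fun ω => ?_)
    simp only; rw [← Real.exp_add]; congr 1; ring
  set a := ∫ ω in K, Real.exp (X ω - m) ∂P with ha
  set b := ∫ ω in K, Real.exp (-(X ω - m)) ∂P with hb
  have hab : a * b ≤ c * p ^ 2 := by
    rw [e1, e2]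
    calc _ = (Real.exp (-m) * Real.exp m) * ((∫ ω in K, Real.exp (X ω) ∂P) * (∫ ω in K, Real.exp (-X ω) ∂P)) := by ring
      _ = _ := by rw [← Real.exp_add]; simp
      _ ≤ _ := h
  have k1 : ∫ ω in K, (X ω - m) ∂P = 0 := by
    rw [integral_sub i1 (integrable_const _)]
    simp only [integral_const, smul_eq_mul, measureReal_restrict_apply_univ]
    rw [hm, ← hp]; field_simp; simp [S]
  have hi : Integrable (fun ω => X ω - m) (P.restrict K) := i1.sub (integrable_const _)
  have a1 : p ≤ a := by
    have : ∫ ω in K, (1 + (X ω - m)) ∂P ≤ a := by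
      apply integral_mono ((integrable_const _).add hi) j1
      intro ω
      show 1 + (X ω - m) ≤ Real.exp (X ω - m)
      linarith [Real.add_one_le_exp (X ω - m)]
    rw [integral_add (integrable_const _) hi, k1] at this
    simpa using this
  have hn : Integrable (fun ω => -(X ω - m)) (P.restrict K) := hi.neg
  have b1 : p ≤ b := by
    have : ∫ ω in K, (1 + (-(X ω - m))) ∂P ≤ b := by
      apply integral_mono ((integrable_const _).add hn) j2
      intro ω
      show 1 + (-(X ω - m)) ≤ Real.exp (-(X ω - m))
      linarith [Real.add_one_le_exp (-(X ω - m))]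
    rw [integral_add (integrable_const _) hn, integral_neg, k1] at this
    simpa using this
  have i3 : Integrable (fun ω => (X ω - m) ^ 2) (P.restrict K) := by
    refine ((i2.sub (i1.const_mul (2 * m))).add (integrable_const (m ^ 2))).congr
      (.of_forall fun ω => ?_)
    simp; ring
  have v1 : ∫ ω in K, (X ω - m) ^ 2 ∂P = (∫ ω in K, X ω ^ 2 ∂P) - S ^ 2 / p := by
    have : ∀ ω, (X ω - m) ^ 2 = (X ω ^ 2 - 2 * m * X ω) + m ^ 2 := fun ω => by ring
    simp only [this]
    have i4 : Integrable (fun ω => X ω ^ 2 - 2 * m * X ω) (P.restrict K) :=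
      i2.sub (i1.const_mul _)
    rw [integral_add i4 (integrable_const _),
      integral_sub i2 (i1.const_mul _), integral_const_mul]
    simp only [integral_const, smul_eq_mul, measureReal_restrict_apply_univ]
    rw [hm, ← hp]; field_simp; ring
  have s1 : 2 * p + (1 / 2) * ((∫ ω in K, X ω ^ 2 ∂P) - S ^ 2 / p) ≤ a + b := by
    rw [← v1, ha, hb, ← integral_add j1 j2]
    have : 2 * p + (1 / 2) * ∫ ω in K, (X ω - m) ^ 2 ∂P =
        ∫ ω in K, (2 + (1 / 2) * (X ω - m) ^ 2) ∂P := by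
      rw [integral_add (integrable_const _) (i3.const_mul _), integral_const_mul]
      simp [mul_comm, hp]
    rw [this]
    apply integral_mono ((integrable_const _).add (i3.const_mul _)) (j1.add j2)
    intro ω
    show 2 + (1 / 2) * (X ω - m) ^ 2 ≤ Real.exp (X ω - m) + Real.exp (-(X ω - m))
    rcases le_total 0 (X ω - m) with hy | hy
    · have := Real.quadratic_le_exp_of_nonneg hy
      have := Real.add_one_le_exp (-(X ω - m))
      linarith
    · have := Real.quadratic_le_exp_of_nonneg (neg_nonneg.2 hy)
      have := Real.add_one_le_exp (X ω - m)
      nlinarith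
  have f1 : p * (a + b - p) ≤ a * b := by nlinarith
  have f2 : p * ((∫ ω in K, X ω ^ 2 ∂P) - S ^ 2 / p) = (∫ ω in K, X ω ^ 2 ∂P) * p - S ^ 2 := by
    field_simp
  rw [← f2]
  nlinarith

theorem gauss_int_sq {Ω : Type*} [MeasurableSpace Ω] (P : Measure Ω)
    (X : Ω → ℝ) (hX : Measurable X) (v : NNReal) (h : P.map X = gaussianReal 0 v) :
    ∫ ω, X ω ^ 2 ∂P = v := by
  have : ∫ x, x ^ 2 ∂(P.map X) = v := by
    rw [h]
    have := variance_id_gaussianReal (μ := 0) (v := v)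
    rw [variance_of_integral_eq_zero aemeasurable_id (by simp)] at this
    simpa using this
  rw [integral_map hX.aemeasurable (by fun_prop)] at this
  exact this

theorem gauss_memLp {Ω : Type*} [MeasurableSpace Ω] (P : Measure Ω)
    (X : Ω → ℝ) (hX : Measurable X) (v : NNReal) (h : P.map X = gaussianReal 0 v) :
    MemLp X 2 P := by
  have : MemLp id 2 (P.map X) := by
    rw [h]; exact memLp_id_gaussianReal 2
  exact (memLp_map_measure_iff (by fun_prop) hX.aemeasurable).1 this

theorem gauss_intexp {Ω : Type*} [MeasurableSpace Ω] (P : Measure Ω)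
    (X : Ω → ℝ) (hX : Measurable X) (v : NNReal) (h : P.map X = gaussianReal 0 v) (c : ℝ) :
    Integrable (fun ω => Real.exp (c * X ω)) P := by
  have : Integrable (fun x => Real.exp (c * x)) (P.map X) := by
    rw [h]; exact integrable_exp_mul_gaussianReal c
  exact (integrable_map_measure (by fun_prop) hX.aemeasurable).1 this

open scoped MatrixOrder in
theorem gauss_repr {Ω ι : Type*} [MeasurableSpace Ω] [Fintype ι] (P : Measure Ω)
    [IsProbabilityMeasure P] (W : ι → Ω → ℝ) (hW : ∀ i, Measurable (W i))
    (hG : ∀ c : ι → ℝ, ∃ v : NNReal, P.map (fun ω => ∑ i, c i * W i ω) = gaussianReal 0 v) :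
    ∃ (n : ℕ) (A : Fin n → ι → ℝ), P.map (fun ω i => W i ω) =
      (Measure.pi (fun _ : Fin n => gaussianReal 0 1)).map (fun x i => ∑ k, x k * A k i) := by
  have mem : ∀ i, MemLp (W i) 2 P := by
    intro i
    obtain ⟨v, hv⟩ := hG (Pi.single i 1)
    have e : (fun ω => ∑ j, (Pi.single i 1 : ι → ℝ) j * W j ω) = W i := by
      ext ω
      rw [Finset.sum_eq_single i]
      · simp
      · intro j _ hj; simp [hj]
      · simp
    rw [e] at hv
    exact gauss_memLp P _ (hW i) v hv
  have ii : ∀ i j, Integrable (fun ω => W i ω * W j ω) P := fun i j => (mem i).integrable_mul (mem j)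
  set S : Matrix ι ι ℝ := fun i j => ∫ ω, W i ω * W j ω ∂P with hS
  have q : ∀ c : ι → ℝ, ∫ ω, (∑ i, c i * W i ω) ^ 2 ∂P = c ⬝ᵥ (Matrix.mulVec S c) := by
    intro c
    have : ∀ ω, (∑ i, c i * W i ω) ^ 2 = ∑ i, ∑ j, c i * c j * (W i ω * W j ω) := by
      intro ω
      rw [sq, Finset.sum_mul_sum]
      refine Finset.sum_congr rfl fun i _ => Finset.sum_congr rfl fun j _ => by ring
    simp only [this]
    rw [integral_finsetSum _ fun i _ => integrable_finsetSum _ fun j _ => (ii i j).const_mul _]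
    simp only [dotProduct, Matrix.mulVec, Finset.mul_sum]
    refine Finset.sum_congr rfl fun i _ => ?_
    rw [integral_finsetSum _ fun j _ => (ii i j).const_mul _]
    refine Finset.sum_congr rfl fun j _ => ?_
    rw [integral_const_mul]
    simp only [hS]; ring
  have psd : S.PosSemidef := by
    refine Matrix.PosSemidef.of_dotProduct_mulVec_nonneg ?_ ?_
    · refine Matrix.IsHermitian.ext fun i j => ?_
      rw [star_trivial]
      show ∫ ω, W j ω * W i ω ∂P = ∫ ω, W i ω * W j ω ∂P
      congr 1; ext ω; ring
    · intro x
      rw [star_trivial, ← q]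
      exact integral_nonneg fun ω => sq_nonneg _
  have key : P.map (fun ω => WithLp.toLp 2 (fun i => W i ω)) = multivariateGaussian 0 S := by
    have : IsProbabilityMeasure (P.map (fun ω => (WithLp.toLp 2 (fun i => W i ω) : EuclideanSpace ℝ ι))) :=
      Measure.isProbabilityMeasure_map (by fun_prop)
    apply Measure.ext_of_charFun
    ext t
    rw [charFun_multivariateGaussian psd, charFun_apply, integral_map (by fun_prop) (by fun_prop)]
    obtain ⟨v, hv⟩ := hG (fun i => t i)
    have hm : Measurable (fun ω => ∑ i, t i * W i ω) := by fun_prop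
    have h1 := charFun_gaussianReal (μ := 0) (v := v) 1
    rw [← hv, charFun_apply, integral_map (by fun_prop) (by fun_prop)] at h1
    have h2 := gauss_int_sq P _ hm v hv
    rw [q] at h2
    convert h1 using 1
    · congr 1; ext ω
      congr 2
      simp [PiLp.inner_apply]
    · rw [h2]; simp
  refine ⟨_, fun k i => (Matrix.toEuclideanCLM (𝕜 := ℝ) (CFC.sqrt S)
    (stdOrthonormalBasis ℝ (EuclideanSpace ℝ ι) k)) i, ?_⟩
  have e1 : P.map (fun ω i => W i ω) =
      (P.map (fun ω => (WithLp.toLp 2 (fun i => W i ω) : EuclideanSpace ℝ ι))).map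
        (fun x i => x i) := by
    rw [Measure.map_map (by fun_prop) (by fun_prop)]; rfl
  rw [e1, key, multivariateGaussian, stdGaussian, Measure.map_map (by fun_prop) (by fun_prop),
    Measure.map_map (by fun_prop) (by fun_prop)]
  congr 1
  ext x i
  simp [Finset.sum_apply]

theorem gauss_cond {Ω ι : Type*} [MeasurableSpace Ω] [Fintype ι] (P : Measure Ω)
    [IsProbabilityMeasure P] (W : ι → Ω → ℝ) (hW : ∀ i, Measurable (W i))
    (hG : ∀ c : ι → ℝ, ∃ v : NNReal, P.map (fun ω => ∑ i, c i * W i ω) = gaussianReal 0 v)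
    (K : Set (ι → ℝ)) (hK : MeasurableSet K)
    (hc : ∀ x ∈ K, ∀ y ∈ K, (fun i => (x i + y i) / 2) ∈ K) (c : ι → ℝ) (κ : ℝ) (hκ : 0 < κ)
    (hv : ∫ ω, (∑ i, c i * W i ω) ^ 2 ∂P ≤ κ) :
    (∫ ω in {ω | (fun i => W i ω) ∈ K}, (∑ i, c i * W i ω) ^ 2 ∂P) *
        P.real {ω | (fun i => W i ω) ∈ K} -
      (∫ ω in {ω | (fun i => W i ω) ∈ K}, (∑ i, c i * W i ω) ∂P) ^ 2 ≤
      4 * κ * P.real {ω | (fun i => W i ω) ∈ K} ^ 2 := by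
  obtain ⟨n, A, hA⟩ := gauss_repr P W hW hG
  set E := {ω | (fun i => W i ω) ∈ K} with hE
  have hWm : Measurable (fun ω i => W i ω) := by fun_prop
  have hEm : MeasurableSet E := hWm hK
  set γ := Measure.pi (fun _ : Fin n => gaussianReal 0 1) with hγ
  set T : (Fin n → ℝ) → ι → ℝ := fun x i => ∑ k, x k * A k i with hT
  have hTm : Measurable T := by
    rw [hT]; fun_prop
  set r := Real.sqrt κ with hr
  have r0 : 0 < r := Real.sqrt_pos.2 hκ
  have rr : r ^ 2 = κ := Real.sq_sqrt hκ.le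
  set ξ : Fin n → ℝ := fun k => (∑ i, c i * A k i) / r with hξ
  have lin : ∀ x : Fin n → ℝ, (∑ i, c i * T x i) / r = ∑ k, x k * ξ k := by
    intro x
    simp only [hT, hξ, Finset.mul_sum, Finset.sum_div, mul_div_assoc']
    rw [Finset.sum_comm]
    refine Finset.sum_congr rfl fun k _ => Finset.sum_congr rfl fun i _ => by ring
  -- second moment
  have sm : ∑ k, ξ k ^ 2 ≤ 1 := by
    have e1 : ∫ ω, (∑ i, c i * W i ω) ^ 2 ∂P = ∫ x, (∑ i, c i * T x i) ^ 2 ∂γ := by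
      have h1 : ∫ y, (∑ i, c i * y i) ^ 2 ∂(P.map (fun ω i => W i ω)) =
        ∫ ω, (∑ i, c i * W i ω) ^ 2 ∂P := by
        rw [integral_map (by fun_prop) (Measurable.aestronglyMeasurable (by fun_prop))]
      have h2 : ∫ y, (∑ i, c i * y i) ^ 2 ∂(γ.map T) = ∫ x, (∑ i, c i * T x i) ^ 2 ∂γ := by
        rw [integral_map (by fun_prop) (Measurable.aestronglyMeasurable (by fun_prop))]
      rw [← h1, ← h2, hA]
    have e2 : ∫ x, (∑ k, x k * ξ k) ^ 2 ∂γ = ∑ k, ξ k ^ 2 := by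
      have := variance_sum_pi (μ := fun _ : Fin n => gaussianReal 0 1)
        (X := fun (k : Fin n) (y : ℝ) => ξ k * y)
        (fun i => IsGaussian.memLp_two_id.const_mul _)
      rw [variance_of_integral_eq_zero] at this
      · have h3 : ∀ k, Var[fun y => ξ k * y; gaussianReal 0 1] = ξ k ^ 2 := by
          intro k
          change Var[fun y => ξ k * id y; gaussianReal 0 1] = _
          rw [variance_const_mul, variance_id_gaussianReal]; simp
        simp only [h3] at this
        rw [← this]
        congr 1; ext x
        simp [mul_comm]
      · fun_prop
      · have : ∀ x : Fin n → ℝ, (∑ i, fun ω : Fin n → ℝ => ξ i * ω i) x = ∑ i, ξ i * x i := by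
          intro x; simp
        simp only [this]
        rw [integral_finsetSum _ fun i _ => (integrable_eval IsGaussian.integrable_id).const_mul _]
        simp [integral_const_mul, integral_eval]
    rw [← e2]
    simp only [← lin, div_pow, rr]
    rw [integral_div, ← e1, div_le_one hκ]
    exact hv
  obtain ⟨v, hGv⟩ := hG c
  have hXm : Measurable (fun ω => ∑ i, c i * W i ω) := by fun_prop
  have tr : ∀ f : (ι → ℝ) → ENNReal, Measurable f →
      ∫⁻ ω in E, f (fun i => W i ω) ∂P = ∫⁻ x in T ⁻¹' K, f (T x) ∂γ := by
    intro f hf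
    rw [← setLIntegral_map hK hf hTm, ← hA, setLIntegral_map hK hf hWm]
    rfl
  have trm : P E = γ (T ⁻¹' K) := by
    have := tr (fun _ => 1) measurable_const
    simpa using this
  have ge := gauss_exp n (T ⁻¹' K) (hTm hK) (by
    intro x hx y hy
    have := hc _ hx _ hy
    show T _ ∈ K
    convert this using 1
    ext i
    simp only [hT]
    rw [← Finset.sum_add_distrib, Finset.sum_div]
    refine Finset.sum_congr rfl fun k _ => by ring) ξ 1 sm
  simp only [← lin] at ge
  rw [← tr (fun y => ENNReal.ofReal (Real.exp ((∑ i, c i * y i) / r))) (by fun_prop),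
    ← tr (fun y => ENNReal.ofReal (Real.exp (-((∑ i, c i * y i) / r)))) (by fun_prop), ← trm] at ge
  have j1 : Integrable (fun ω => Real.exp ((∑ i, c i * W i ω) / r)) P := by
    have := gauss_intexp P _ hXm v hGv (1 / r)
    refine this.congr (.of_forall fun ω => ?_)
    show Real.exp _ = Real.exp _
    congr 1; ring
  have j2 : Integrable (fun ω => Real.exp (-((∑ i, c i * W i ω) / r))) P := by
    have := gauss_intexp P _ hXm v hGv (-1 / r)
    refine this.congr (.of_forall fun ω => ?_)
    show Real.exp _ = Real.exp _
    congr 1; ring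
  rw [← ofReal_integral_eq_lintegral_ofReal j1.restrict (.of_forall fun _ => by positivity),
    ← ofReal_integral_eq_lintegral_ofReal j2.restrict (.of_forall fun _ => by positivity),
    ← ENNReal.ofReal_mul (by positivity)] at ge
  have pe : P E = ENNReal.ofReal (P.real E) := by simp
  rw [pe, ← ENNReal.ofReal_pow (by positivity), ← ENNReal.ofReal_mul (by positivity),
    ENNReal.ofReal_le_ofReal_iff (by positivity)] at ge
  have fin := var_from_exp P (fun ω => (∑ i, c i * W i ω) / r) E hEm
    (by simpa [div_eq_inv_mul] using (gauss_memLp P _ hXm v hGv).const_mul r⁻¹) j1 j2 _ ge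
  simp only [div_pow, rr] at fin
  rw [integral_div, integral_div, div_pow, rr] at fin
  have e3 := Real.exp_one_lt_d9
  have : ((∫ ω in E, (∑ i, c i * W i ω) ^ 2 ∂P) * P.real E -
      (∫ ω in E, (∑ i, c i * W i ω) ∂P) ^ 2) / κ ≤ 4 * P.real E ^ 2 := by
    calc _ = _ := by ring
      _ ≤ _ := fin
      _ ≤ _ := by nlinarith [sq_nonneg (P.real E)]
  rw [div_le_iff₀ hκ] at this
  linarith

open Filter Topology in
theorem cond_pass {Ω E' : Type*} [MeasurableSpace Ω] (P : Measure Ω) [IsProbabilityMeasure P]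
    [NormedAddCommGroup E'] [NormedSpace ℝ E'] [FiniteDimensional ℝ E'] [mE : MeasurableSpace E']
    [BorelSpace E'] (Y : Ω → E') (hY : Measurable Y) (H : Set Ω) (hH : MeasurableSet H)
    (X : Ω → ℝ) (hX : MemLp X 2 P) (κ : ℝ)
    (hin : ∀ (y : E') (r : ℝ),
      (∫ ω in H ∩ Y ⁻¹' Metric.closedBall y r, X ω ^ 2 ∂P) *
        P.real (H ∩ Y ⁻¹' Metric.closedBall y r) -
      (∫ ω in H ∩ Y ⁻¹' Metric.closedBall y r, X ω ∂P) ^ 2 ≤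
      κ * P.real (H ∩ Y ⁻¹' Metric.closedBall y r) ^ 2) :
    ∀ᵐ ω ∂P, (P[H.indicator (fun ω => X ω ^ 2) | MeasurableSpace.comap Y mE]) ω *
        (P[H.indicator (fun _ => (1 : ℝ)) | MeasurableSpace.comap Y mE]) ω -
        (P[H.indicator X | MeasurableSpace.comap Y mE]) ω ^ 2 ≤
      κ * (P[H.indicator (fun _ => (1 : ℝ)) | MeasurableSpace.comap Y mE]) ω ^ 2 := by
  have hm : MeasurableSpace.comap Y mE ≤ ‹MeasurableSpace Ω› := hY.comap_le
  set ν := P.map Y with hν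
  have : IsProbabilityMeasure ν := Measure.isProbabilityMeasure_map hY.aemeasurable
  have fac : ∀ Z : Ω → ℝ, Integrable Z P → ∃ f : E' → ℝ,
      (P[H.indicator Z | MeasurableSpace.comap Y mE] = f ∘ Y) ∧
      (∀ B : Set E', MeasurableSet B → ∫ y in B, f y ∂ν = ∫ ω in H ∩ Y ⁻¹' B, Z ω ∂P) ∧
      (∀ᵐ y ∂ν, Tendsto (fun r => ⨍ z in Metric.closedBall y r, f z ∂ν) (𝓝[>] 0) (𝓝 (f y))) := by
    intro Z hZ
    have hZH : Integrable (H.indicator Z) P := hZ.indicator hH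
    obtain ⟨f, hf, hfe⟩ := (stronglyMeasurable_condExp (f := H.indicator Z) (μ := P)
      (m := MeasurableSpace.comap Y mE)).exists_eq_measurable_comp
    have hfi : Integrable f ν := by
      rw [hν, integrable_map_measure hf.aestronglyMeasurable hY.aemeasurable, ← hfe]
      exact integrable_condExp
    refine ⟨f, hfe, ?_, ?_⟩
    · intro B hB
      rw [hν, setIntegral_map hB hf.aestronglyMeasurable hY.aemeasurable]
      have : ∫ ω in Y ⁻¹' B, f (Y ω) ∂P =
          ∫ ω in Y ⁻¹' B, (P[H.indicator Z | MeasurableSpace.comap Y mE]) ω ∂P := by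
        rw [hfe]; rfl
      rw [this, setIntegral_condExp hm hZH ⟨B, hB, rfl⟩, setIntegral_indicator hH, inter_comm]
    · filter_upwards [(Besicovitch.vitaliFamily ν).ae_tendsto_average hfi.locallyIntegrable] with y hy
      exact hy.comp (Besicovitch.tendsto_filterAt ν y)
  obtain ⟨f2, h2, i2, t2⟩ := fac _ hX.integrable_sq
  obtain ⟨f1, h1, i1, t1⟩ := fac X (hX.integrable (by norm_num))
  obtain ⟨f0, h0, i0, t0⟩ := fac (fun _ => 1) (integrable_const _)
  rw [h2, h1, h0]
  have : ∀ᵐ y ∂ν, f2 y * f0 y - f1 y ^ 2 ≤ κ * f0 y ^ 2 := by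
    filter_upwards [t2, t1, t0] with y t2 t1 t0
    refine le_of_tendsto_of_tendsto' ((t2.mul t0).sub (t1.pow 2)) ((t0.pow 2).const_mul κ) ?_
    intro r
    have hb : MeasurableSet (Metric.closedBall y r) := Metric.isClosed_closedBall.measurableSet
    simp only [setAverage_eq, smul_eq_mul]
    rw [i2 _ hb, i1 _ hb, i0 _ hb]
    have e0 : ∫ ω in H ∩ Y ⁻¹' Metric.closedBall y r, (1 : ℝ) ∂P =
      P.real (H ∩ Y ⁻¹' Metric.closedBall y r) := by simp
    rw [e0]
    have := mul_le_mul_of_nonneg_left (hin y r) (sq_nonneg (ν.real (Metric.closedBall y r))⁻¹)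
    linarith
  exact ae_of_ae_map hY.aemeasurable this

theorem cond_pass' {Ω E' : Type*} [MeasurableSpace Ω] (P : Measure Ω) [IsProbabilityMeasure P]
    [NormedAddCommGroup E'] [NormedSpace ℝ E'] [FiniteDimensional ℝ E'] [mE : MeasurableSpace E']
    [BorelSpace E'] (Y : Ω → E') (hY : Measurable Y) (H : Set Ω) (hH : MeasurableSet H)
    (X : Ω → ℝ) (hX : MemLp X 2 P) (κ : ℝ) (g : E' → ℝ) (hg : Measurable g)
    (hgX : MemLp (g ∘ Y) 2 P)
    (hin : ∀ (y : E') (r : ℝ),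
      (∫ ω in H ∩ Y ⁻¹' Metric.closedBall y r, X ω ^ 2 ∂P) *
        P.real (H ∩ Y ⁻¹' Metric.closedBall y r) -
      (∫ ω in H ∩ Y ⁻¹' Metric.closedBall y r, X ω ∂P) ^ 2 ≤
      κ * P.real (H ∩ Y ⁻¹' Metric.closedBall y r) ^ 2) :
    ∀ᵐ ω ∂P, (P[H.indicator (fun ω => (X ω + g (Y ω)) ^ 2) | MeasurableSpace.comap Y mE]) ω *
        (P[H.indicator (fun _ => (1 : ℝ)) | MeasurableSpace.comap Y mE]) ω -
        (P[H.indicator (fun ω => X ω + g (Y ω)) | MeasurableSpace.comap Y mE]) ω ^ 2 ≤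
      κ * (P[H.indicator (fun _ => (1 : ℝ)) | MeasurableSpace.comap Y mE]) ω ^ 2 := by
  have hm : MeasurableSpace.comap Y mE ≤ ‹MeasurableSpace Ω› := hY.comap_le
  have cp := cond_pass P Y hY H hH X hX κ hin
  set m := MeasurableSpace.comap Y mE with hmdef
  set L : Ω → ℝ := g ∘ Y with hL
  have mL : StronglyMeasurable[m] L :=
    (hg.comp (comap_measurable Y)).stronglyMeasurable
  have mL2 : StronglyMeasurable[m] (fun ω => L ω ^ 2) := mL.pow 2
  have mL3 : StronglyMeasurable[m] (fun ω => 2 * L ω) := mL.const_mul 2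
  have a2 := hX.integrable_sq.indicator hH
  have a1 := (hX.integrable (by norm_num)).indicator hH
  have a0 : Integrable (H.indicator fun _ => (1 : ℝ)) P := (integrable_const (1 : ℝ)).indicator hH
  have b1 : Integrable ((fun ω => 2 * L ω) * H.indicator X) P := by
    have := (((hgX.integrable_mul hX).const_mul 2).indicator hH)
    refine this.congr (.of_forall fun ω => ?_)
    by_cases h : ω ∈ H <;> simp [h, hL, mul_assoc]
  have b0 : Integrable (L * H.indicator fun _ => (1 : ℝ)) P := by
    have := ((hgX.integrable (by norm_num)).indicator hH)
    refine this.congr (.of_forall fun ω => ?_)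
    by_cases h : ω ∈ H <;> simp [h, hL]
  have c0 : Integrable ((fun ω => L ω ^ 2) * H.indicator fun _ => (1 : ℝ)) P := by
    have := (hgX.integrable_sq.indicator hH)
    refine this.congr (.of_forall fun ω => ?_)
    by_cases h : ω ∈ H <;> simp [h, hL]
  have e2 : H.indicator (fun ω => (X ω + g (Y ω)) ^ 2) = H.indicator (fun ω => X ω ^ 2) +
      ((fun ω => 2 * L ω) * H.indicator X + (fun ω => L ω ^ 2) * H.indicator fun _ => (1 : ℝ)) := by
    ext ω
    by_cases h : ω ∈ H <;> simp [h, hL]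
    ring
  have e1 : H.indicator (fun ω => X ω + g (Y ω)) = H.indicator X +
      L * H.indicator fun _ => (1 : ℝ) := by
    ext ω
    by_cases h : ω ∈ H <;> simp [h, hL]
  rw [e2, e1]
  filter_upwards [cp, condExp_add a2 (b1.add c0) m,
    condExp_add b1 c0 m, condExp_add a1 b0 m, condExp_mul_of_stronglyMeasurable_left mL3 b1 a1,
    condExp_mul_of_stronglyMeasurable_left mL2 c0 a0,
    condExp_mul_of_stronglyMeasurable_left mL b0 a0] with ω k q1 q2 q3 q4 q5 q6
  rw [q1, q3, Pi.add_apply, q2, Pi.add_apply, Pi.add_apply, q4, q5, q6]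
  simp only [Pi.mul_apply]
  refine le_trans (le_of_eq ?_) k
  ring

theorem fam_sum {Ω ι κ : Type*} [MeasurableSpace Ω] (P : Measure Ω)
    (f : ι → Ω → ℝ) (K : ι → ι → ℝ) (S : Set ι) (h : IsGaussFam P f K S)
    (s : Finset κ) (i : κ → ι) (hi : ∀ k ∈ s, i k ∈ S) (c : κ → ℝ) :
    P.map (fun ω => ∑ k ∈ s, c k * f (i k) ω) =
      gaussianReal 0 (∑ k ∈ s, ∑ l ∈ s, c k * c l * K (i k) (i l)).toNNReal := by
  set l : ι →₀ ℝ := ∑ k ∈ s, Finsupp.single (i k) (c k) with hl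
  have key : ∀ F : ι → ℝ, ∑ j ∈ l.support, l j * F j = ∑ k ∈ s, c k * F (i k) := by
    intro F
    have : l.sum (fun j a => a * F j) = ∑ k ∈ s, c k * F (i k) := by
      rw [hl, ← Finsupp.sum_finsetSum_index (by simp) (by intros; ring)]
      refine Finset.sum_congr rfl fun k _ => ?_
      rw [Finsupp.sum_single_index (by simp)]
    exact this
  have hsup : ↑l.support ⊆ S := by
    intro j hj
    have h1 := Finsupp.support_finset_sum (s := s) (f := fun k => Finsupp.single (i k) (c k)) hj
    rw [Finset.mem_biUnion] at h1
    obtain ⟨k, hk, hk2⟩ := h1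
    have := Finsupp.support_single_subset hk2
    rw [Finset.mem_singleton] at this
    rw [this]; exact hi k hk
  have h2 := h.2 l hsup
  have e1 : (fun ω => ∑ j ∈ l.support, l j * f j ω) = fun ω => ∑ k ∈ s, c k * f (i k) ω := by
    ext ω; exact key fun j => f j ω
  have e2 : ∑ j ∈ l.support, ∑ j' ∈ l.support, l j * l j' * K j j' =
      ∑ k ∈ s, ∑ l ∈ s, c k * c l * K (i k) (i l) := by
    simp only [mul_assoc, ← Finset.mul_sum]
    rw [key fun j => ∑ j' ∈ l.support, l j' * K j j']
    refine Finset.sum_congr rfl fun k _ => ?_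
    rw [key fun j' => K (i k) j']
  rw [e1, e2] at h2
  exact h2

theorem fam_sq {Ω ι κ : Type*} [MeasurableSpace Ω] (P : Measure Ω)
    (f : ι → Ω → ℝ) (K : ι → ι → ℝ) (S : Set ι) (h : IsGaussFam P f K S)
    (s : Finset κ) (i : κ → ι) (hi : ∀ k ∈ s, i k ∈ S) (c : κ → ℝ) (b : ℝ) (hb : 0 ≤ b)
    (hq : ∑ k ∈ s, ∑ l ∈ s, c k * c l * K (i k) (i l) ≤ b) :
    ∫ ω, (∑ k ∈ s, c k * f (i k) ω) ^ 2 ∂P ≤ b := by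
  have hm : Measurable (fun ω => ∑ k ∈ s, c k * f (i k) ω) := by
    have := h.1
    fun_prop
  rw [gauss_int_sq P _ hm _ (fam_sum P f K S h s i hi c)]
  rw [Real.coe_toNNReal']
  exact max_le hq hb

theorem sum_nbrs (u : ℤ × ℤ) (F : ℤ × ℤ → ℝ) : ∑ w ∈ nbrs u, F w =
    F (u.1 + 1, u.2) + F (u.1 - 1, u.2) + F (u.1, u.2 + 1) + F (u.1, u.2 - 1) := by
  unfold nbrs
  rw [Finset.sum_insert, Finset.sum_insert, Finset.sum_insert, Finset.sum_singleton]
  · ring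
  all_goals
    simp only [Finset.mem_insert, Finset.mem_singleton, Prod.mk.injEq, not_or]
    omega

theorem mem_nbrs_iff (u v : ℤ × ℤ) : v ∈ nbrs u ↔ adj u v := by
  obtain ⟨a, b⟩ := u
  obtain ⟨c, d⟩ := v
  simp only [nbrs, adj, Finset.mem_insert, Finset.mem_singleton, Prod.mk.injEq]
  grind

theorem adj_symm (u v : ℤ × ℤ) (h : adj u v) : adj v u := by
  unfold adj at *
  rw [abs_sub_comm, abs_sub_comm v.2]; exact h

theorem box_mem (N : ℕ) (u : ℤ × ℤ) : u ∈ box N ↔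
    (-(((N : ℤ) - 1) / 2) ≤ u.1 ∧ u.1 ≤ (N : ℤ) / 2) ∧
      (-(((N : ℤ) - 1) / 2) ≤ u.2 ∧ u.2 ≤ (N : ℤ) / 2) := by
  unfold box
  rw [Finset.mem_product, Finset.mem_Icc, Finset.mem_Icc]

theorem nbrs_box (N : ℕ) (u : ℤ × ℤ) (hu : u ∈ box N) (hb : u ∉ bdry N) :
    ∀ w ∈ nbrs u, w ∈ box N := by
  intro w hw
  by_contra h
  exact hb (by unfold bdry; rw [Finset.mem_filter]; exact ⟨hu, w, hw, h⟩)

theorem ks_nonneg (K : Set (ℤ × ℤ)) (n : ℕ) : ∀ u v, 0 ≤ killedStep K n u v := by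
  induction n with
  | zero => intro u v; unfold killedStep; split_ifs <;> norm_num
  | succ n ih =>
    intro u v; unfold killedStep; split_ifs
    · exact le_rfl
    · have := Finset.sum_nonneg fun w (_ : w ∈ nbrs u) => ih w v
      linarith

theorem ks_sum (N : ℕ) (v : ℤ × ℤ) (n : ℕ) : ∀ u ∈ box N,
    ∑ k ∈ Finset.range n, killedStep (↑(bdry N)) k u v ≤
      2 * (N : ℝ) ^ 2 - ((u.1 : ℝ) ^ 2 + (u.2 : ℝ) ^ 2) := by
  have hb : ∀ u ∈ box N, 0 ≤ 2 * (N : ℝ) ^ 2 - ((u.1 : ℝ) ^ 2 + (u.2 : ℝ) ^ 2) := by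
    intro u hu
    rw [box_mem] at hu
    have h1 : u.1 ^ 2 ≤ (N : ℤ) ^ 2 := sq_le_sq' (by omega) (by omega)
    have h2 : u.2 ^ 2 ≤ (N : ℤ) ^ 2 := sq_le_sq' (by omega) (by omega)
    have h1' : (u.1 : ℝ) ^ 2 ≤ (N : ℝ) ^ 2 := by exact_mod_cast h1
    have h2' : (u.2 : ℝ) ^ 2 ≤ (N : ℝ) ^ 2 := by exact_mod_cast h2
    linarith
  induction n with
  | zero => intro u hu; simpa using hb u hu
  | succ n ih =>
    intro u hu
    rw [Finset.sum_range_succ']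
    by_cases hK : u ∈ bdry N
    · have : ∀ k, killedStep (↑(bdry N)) k u v = 0 := by
        intro k; cases k <;> simp [killedStep, hK]
      simp only [this, Finset.sum_const_zero, add_zero]
      exact hb u hu
    · have e0 : killedStep (↑(bdry N)) 0 u v ≤ 1 := by
        simp only [killedStep]; split_ifs <;> norm_num
      have e1 : ∀ k, killedStep (↑(bdry N)) (k + 1) u v =
          (1 / 4) * ∑ w ∈ nbrs u, killedStep (↑(bdry N)) k w v := by
        intro k; simp [killedStep, hK]
      simp only [e1, ← Finset.mul_sum]
      rw [Finset.sum_comm]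
      have := Finset.sum_le_sum fun w (hw : w ∈ nbrs u) => ih w (nbrs_box N u hu hK w hw)
      rw [sum_nbrs u fun w => 2 * (N : ℝ) ^ 2 - ((w.1 : ℝ) ^ 2 + (w.2 : ℝ) ^ 2)] at this
      push_cast at this
      nlinarith

theorem ks_summable (N : ℕ) (v u : ℤ × ℤ) (hu : u ∈ box N) :
    Summable fun k => killedStep (↑(bdry N)) k u v :=
  summable_of_sum_range_le (fun k => ks_nonneg _ k u v) fun n => ks_sum N v n u hu

theorem green_bdry (N : ℕ) (u v : ℤ × ℤ) (hu : u ∈ bdry N) : green N u v = 0 := by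
  have : ∀ k, killedStep (↑(bdry N)) k u v = 0 := by
    intro k; cases k <;> simp [killedStep, hu]
  simp [green, greenK, this]

theorem green_rec (N : ℕ) (u v : ℤ × ℤ) (hu : u ∈ box N) (hb : u ∉ bdry N) :
    green N u v = (if u = v then 1 else 0) + (1 / 4) * ∑ w ∈ nbrs u, green N w v := by
  unfold green greenK
  rw [(ks_summable N v u hu).tsum_eq_zero_add]
  have e1 : ∀ k, killedStep (↑(bdry N)) (k + 1) u v =
      (1 / 4) * ∑ w ∈ nbrs u, killedStep (↑(bdry N)) k w v := by
    intro k; simp [killedStep, hb]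
  simp only [e1]
  rw [tsum_mul_left, Summable.tsum_finsetSum fun w hw => ks_summable N v w (nbrs_box N u hu hb w hw)]
  congr 1
  simp [killedStep, hb]

theorem gff_rec (N : ℕ) (u v : ℤ × ℤ) (hu : u ∈ box N) (hb : u ∉ bdry N) (hv : v ∈ box N) :
    ∑ w ∈ nbrs u, (gffCov N u v - gffCov N w v) = if u = v then 1 else 0 := by
  have h1 : ∀ w ∈ nbrs u, gffCov N u v - gffCov N w v =
      (1 / 4) * green N u v - (1 / 4) * green N w v := by
    intro w hw
    simp [gffCov, hu, hv, nbrs_box N u hu hb w hw]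
  rw [Finset.sum_congr rfl h1, Finset.sum_sub_distrib, ← Finset.mul_sum]
  have h2 := green_rec N u v hu hb
  rw [sum_nbrs u fun _ => green N u v, ← Finset.mul_sum]
  linarith

theorem grad_bound (N : ℕ) (J : Finset (ℤ × ℤ)) (nb : ℤ × ℤ → ℤ × ℤ) (c : ℤ × ℤ → ℝ)
    (h1 : ∀ v ∈ J, v ∈ box N) (h2 : ∀ v ∈ J, nb v ∈ box N) (h3 : ∀ v ∈ J, adj v (nb v)) :
    ∑ v ∈ J, ∑ w ∈ J, c v * c w * ((gffCov N v w - gffCov N v (nb w)) -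
      (gffCov N (nb v) w - gffCov N (nb v) (nb w))) ≤ 2 * ∑ v ∈ J, c v ^ 2 := by
  set ψ : ℤ × ℤ → ℝ := fun x => ∑ w ∈ J, c w * (gffCov N x w - gffCov N x (nb w)) with hψ
  set l : ℤ × ℤ → ℝ := fun x => ∑ w ∈ J, c w * ((if x = w then 1 else 0) - (if x = nb w then 1 else 0))
    with hl
  have q1 : ∑ v ∈ J, ∑ w ∈ J, c v * c w * ((gffCov N v w - gffCov N v (nb w)) -
      (gffCov N (nb v) w - gffCov N (nb v) (nb w))) = ∑ v ∈ J, c v * (ψ v - ψ (nb v)) := by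
    refine Finset.sum_congr rfl fun v _ => ?_
    rw [hψ, ← Finset.sum_sub_distrib, Finset.mul_sum]
    refine Finset.sum_congr rfl fun w _ => by ring
  rw [q1]
  have ψb : ∀ x ∈ bdry N, ψ x = 0 := by
    intro x hx
    simp [hψ, gffCov, green_bdry N x _ hx]
  have ψr : ∀ x ∈ box N, x ∉ bdry N → ∑ y ∈ nbrs x, (ψ x - ψ y) = l x := by
    intro x hx hb
    simp only [hψ, hl, ← Finset.sum_sub_distrib]
    rw [Finset.sum_comm]
    refine Finset.sum_congr rfl fun w hw => ?_
    rw [← gff_rec N x w hx hb (h1 w hw), ← gff_rec N x (nb w) hx hb (h2 w hw),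
      ← Finset.sum_sub_distrib, Finset.mul_sum]
    refine Finset.sum_congr rfl fun y _ => by ring
  have q2 : ∑ v ∈ J, c v * (ψ v - ψ (nb v)) = ∑ x ∈ box N, ψ x * l x := by
    simp only [hl, Finset.mul_sum]
    rw [Finset.sum_comm]
    refine Finset.sum_congr rfl fun v hv => ?_
    have a : ∀ z ∈ box N, ∑ x ∈ box N, ψ x * (if x = z then 1 else 0) = ψ z := by
      intro z hz
      simp [hz]
    rw [← a v (h1 v hv), ← a (nb v) (h2 v hv), ← Finset.sum_sub_distrib, Finset.mul_sum]
    refine Finset.sum_congr rfl fun y _ => by ring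
  set D := ∑ x ∈ box N, ∑ y ∈ box N, (if adj x y then (ψ x - ψ y) ^ 2 else 0) with hD
  have d1 : D = 2 * ∑ x ∈ box N, ψ x * l x := by
    have e1 : ∀ x ∈ box N, ψ x * l x = ∑ y ∈ box N, if adj x y then ψ x * (ψ x - ψ y) else 0 := by
      intro x hx
      by_cases hb : x ∈ bdry N
      · simp [ψb x hb]
      · rw [← ψr x hx hb, Finset.mul_sum, ← Finset.sum_filter]
        refine Finset.sum_congr ?_ fun _ _ => rfl
        ext y
        rw [Finset.mem_filter, mem_nbrs_iff]
        exact ⟨fun h => ⟨nbrs_box N x hx hb y ((mem_nbrs_iff x y).2 h), h⟩, fun h => h.2⟩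
    have e2 : ∑ x ∈ box N, ψ x * l x =
        ∑ x ∈ box N, ∑ y ∈ box N, if adj x y then ψ x * (ψ x - ψ y) else 0 :=
      Finset.sum_congr rfl e1
    have e3 : ∑ x ∈ box N, ψ x * l x =
        ∑ x ∈ box N, ∑ y ∈ box N, if adj x y then ψ y * (ψ y - ψ x) else 0 := by
      rw [e2, Finset.sum_comm]
      refine Finset.sum_congr rfl fun x _ => Finset.sum_congr rfl fun y _ => ?_
      have : adj y x ↔ adj x y := ⟨adj_symm _ _, adj_symm _ _⟩
      simp only [this]
    rw [two_mul]
    nth_rewrite 1 [e2]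
    rw [e3, ← Finset.sum_add_distrib, hD]
    refine Finset.sum_congr rfl fun x _ => ?_
    rw [← Finset.sum_add_distrib]
    refine Finset.sum_congr rfl fun y _ => ?_
    split_ifs
    · ring
    · ring
  have d2 : ∑ v ∈ J, (ψ v - ψ (nb v)) ^ 2 ≤ D := by
    calc ∑ v ∈ J, (ψ v - ψ (nb v)) ^ 2
        ≤ ∑ x ∈ J, ∑ y ∈ box N, (if adj x y then (ψ x - ψ y) ^ 2 else 0) := by
          refine Finset.sum_le_sum fun v hv => ?_
          have := Finset.single_le_sum (f := fun y => if adj v y then (ψ v - ψ y) ^ 2 else 0)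
            (fun y _ => by positivity) (h2 v hv)
          simpa [h3 v hv] using this
      _ ≤ D := by
          apply Finset.sum_le_sum_of_subset_of_nonneg h1
          intro x _ _
          exact Finset.sum_nonneg fun y _ => by positivity
  have d3 : ∑ v ∈ J, c v * (ψ v - ψ (nb v)) ≤ ∑ v ∈ J, c v ^ 2 +
      (1 / 4) * ∑ v ∈ J, (ψ v - ψ (nb v)) ^ 2 := by
    rw [Finset.mul_sum, ← Finset.sum_add_distrib]
    refine Finset.sum_le_sum fun v _ => ?_
    nlinarith [sq_nonneg (c v - (ψ v - ψ (nb v)) / 2)]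
  linarith

theorem bridge_bound (N : ℕ) (J : Finset (ℤ × ℤ)) (nb : ℤ × ℤ → ℤ × ℤ) (a t : ℤ × ℤ → ℝ)
    (ha : ∀ v ∈ J, 0 ≤ a v) (ht : ∀ v ∈ J, 0 ≤ t v ∧ t v ≤ 4) :
    ∑ v ∈ J, ∑ w ∈ J, a v * a w * m2Cov N (.inr (v, nb v, true, t v)) (.inr (w, nb w, true, t w)) ≤
      16 * ∑ v ∈ J, a v ^ 2 := by
  have hb : ∀ s t : ℝ, 0 ≤ s → s ≤ 4 → 0 ≤ t → t ≤ 4 → bridgeCov 4 s t ≤ 8 := by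
    intro s t h1 h2 h3 h4
    unfold bridgeCov
    have : min s t ≤ 4 := (min_le_left _ _).trans h2
    have : 0 ≤ s * t / 4 := by positivity
    linarith
  have k1 : ∀ v ∈ J, ∀ w ∈ J,
      a v * a w * m2Cov N (.inr (v, nb v, true, t v)) (.inr (w, nb w, true, t w)) ≤
      (if w = v then 8 * a v ^ 2 else 0) + ((if w = nb v then 4 * a v ^ 2 else 0) +
        (if v = nb w then 4 * a w ^ 2 else 0)) := by
    intro v hv w hw
    have hav := ha v hv
    have haw := ha w hw
    have p0 := mul_nonneg hav haw
    obtain ⟨t1, t2⟩ := ht v hv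
    obtain ⟨t3, t4⟩ := ht w hw
    have n1 : 0 ≤ (if w = v then 8 * a v ^ 2 else 0) := by positivity
    have n2 : 0 ≤ (if w = nb v then 4 * a v ^ 2 else 0) := by positivity
    have n3 : 0 ≤ (if v = nb w then 4 * a w ^ 2 else 0) := by positivity
    simp only [m2Cov, edgeLen, if_true]
    by_cases c1 : v = w ∧ nb v = nb w
    · rw [if_pos c1, if_pos c1.1.symm]
      have := hb (t v) (t w) t1 t2 t3 t4
      have e := mul_le_mul_of_nonneg_left this p0
      have e2 : a v * a w = a v ^ 2 := by rw [← c1.1]; ring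
      rw [e2] at e ⊢
      linarith
    · rw [if_neg c1]
      by_cases c2 : v = nb w ∧ nb v = w
      · rw [if_pos c2, if_pos c2.2.symm, if_pos c2.1]
        have := hb (t v) (4 - t w) t1 t2 (by linarith) (by linarith)
        nlinarith [sq_nonneg (a v - a w)]
      · rw [if_neg c2]
        linarith
  refine (Finset.sum_le_sum fun v hv => Finset.sum_le_sum fun w hw => k1 v hv w hw).trans ?_
  simp only [Finset.sum_add_distrib]
  have s1 : ∑ v ∈ J, ∑ w ∈ J, (if w = v then 8 * a v ^ 2 else 0) ≤ 8 * ∑ v ∈ J, a v ^ 2 := by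
    rw [Finset.mul_sum]
    refine Finset.sum_le_sum fun v _ => ?_
    rw [Finset.sum_ite_eq']
    split_ifs <;> first | exact le_rfl | positivity
  have s2 : ∑ v ∈ J, ∑ w ∈ J, (if w = nb v then 4 * a v ^ 2 else 0) ≤ 4 * ∑ v ∈ J, a v ^ 2 := by
    rw [Finset.mul_sum]
    refine Finset.sum_le_sum fun v _ => ?_
    rw [Finset.sum_ite_eq']
    split_ifs <;> first | exact le_rfl | positivity
  have s3 : ∑ v ∈ J, ∑ w ∈ J, (if v = nb w then 4 * a w ^ 2 else 0) ≤ 4 * ∑ v ∈ J, a v ^ 2 := by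
    rw [Finset.sum_comm]; exact s2
  linarith

theorem netCond_nonneg (N : ℕ) (x z : NIdx) : 0 ≤ netCond N x z := by
  rcases x with x | ⟨a, b, j⟩ <;> rcases z with z | ⟨a', b', j'⟩ <;> simp only [netCond] <;> positivity

theorem netStep_nonneg (N : ℕ) (A : Set NIdx) (n : ℕ) : ∀ x y, 0 ≤ netStep N A n x y := by
  induction n with
  | zero => intro x y; unfold netStep; split_ifs <;> norm_num
  | succ n ih =>
    intro x y; unfold netStep; split_ifs
    · exact le_rfl
    · exact Finset.sum_nonneg fun z _ => mul_nonneg (div_nonneg (netCond_nonneg _ _ _)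
        (Finset.sum_nonneg fun z _ => netCond_nonneg _ _ _)) (ih z y)

theorem net_super (N : ℕ) (F : NIdx → ℝ) (x : NIdx) (hx : 0 ≤ F x)
    (h : ∑ z ∈ nodeNbrs N x, netCond N x z * (F z - F x) ≤ 0) :
    ∑ z ∈ nodeNbrs N x, (netCond N x z / ∑ z' ∈ nodeNbrs N x, netCond N x z') * F z ≤ F x := by
  set S := ∑ z' ∈ nodeNbrs N x, netCond N x z' with hS
  have S0 : 0 ≤ S := Finset.sum_nonneg fun z _ => netCond_nonneg _ _ _
  have e : ∑ z ∈ nodeNbrs N x, (netCond N x z / S) * F z =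
      (∑ z ∈ nodeNbrs N x, netCond N x z * F z) / S := by
    rw [Finset.sum_div]; exact Finset.sum_congr rfl fun z _ => by ring
  have e2 : ∑ z ∈ nodeNbrs N x, netCond N x z * (F z - F x) =
      (∑ z ∈ nodeNbrs N x, netCond N x z * F z) - S * F x := by
    rw [hS, Finset.sum_mul, ← Finset.sum_sub_distrib]
    exact Finset.sum_congr rfl fun z _ => by ring
  rw [e]
  rcases S0.eq_or_lt with h0 | h0
  · rw [← h0]; simpa using hx
  · rw [div_le_iff₀ h0]; linarith

theorem net_partial (N : ℕ) (A : Set NIdx) (F : NIdx → ℝ) (Y : Finset NIdx) (h0 : ∀ x, 0 ≤ F x)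
    (hY : ∀ y ∈ Y, 1 ≤ F y)
    (h : ∀ x ∉ A, ∑ z ∈ nodeNbrs N x, netCond N x z * (F z - F x) ≤ 0) (n : ℕ) :
    ∀ x, ∑ k ∈ Finset.range n, ∑ y ∈ Y, netStep N A k x y ≤ F x := by
  induction n with
  | zero => intro x; simpa using h0 x
  | succ n ih =>
    intro x
    rw [Finset.sum_range_succ']
    by_cases hx : x ∈ A
    · have e : ∀ k y, netStep N A (k + 1) x y = 0 := by intro k y; simp [netStep, hx]
      have e0 : ∀ y, netStep N A 0 x y = if x = y then 1 else 0 := by intro y; simp [netStep, hx]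
      simp only [e, e0, Finset.sum_const_zero, zero_add, Finset.sum_ite_eq]
      split_ifs with h1
      · exact hY x h1
      · exact h0 x
    · have e0 : ∀ y, netStep N A 0 x y = 0 := by intro y; simp [netStep, hx]
      have e : ∀ k y, netStep N A (k + 1) x y = ∑ z ∈ nodeNbrs N x,
        (netCond N x z / ∑ z' ∈ nodeNbrs N x, netCond N x z') * netStep N A k z y := by
        intro k y; simp [netStep, hx]
      simp only [e0, e, Finset.sum_const_zero, add_zero]
      refine le_trans (le_of_eq ?_) ((Finset.sum_le_sum fun z _ =>
        mul_le_mul_of_nonneg_left (ih z) ?_).trans (net_super N F x (h0 x) (h x hx)))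
      · simp only [Finset.mul_sum]
        rw [Finset.sum_comm]
        conv_rhs => rw [Finset.sum_comm]
        rw [Finset.sum_comm]
        refine Finset.sum_congr rfl fun k _ => ?_
        rw [Finset.sum_comm]
      · exact div_nonneg (netCond_nonneg _ _ _) (Finset.sum_nonneg fun z _ => netCond_nonneg _ _ _)

theorem net_summable (N : ℕ) (A : Set NIdx) (x y : NIdx) :
    Summable fun n => netStep N A n x y := by
  refine summable_of_sum_range_le (c := 1) (fun k => netStep_nonneg _ _ k x y) fun n => ?_
  simpa using net_partial N A (fun _ => 1) {y} (by simp) (by simp) (by simp) n x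

theorem hm_nonneg (N : ℕ) (A : Set NIdx) (x y : NIdx) : 0 ≤ hmNet N A x y :=
  tsum_nonneg fun n => netStep_nonneg N A n x y

theorem hm_total (N : ℕ) (A : Set NIdx) (x : NIdx) (J : Finset (ℤ × ℤ)) :
    ∑ v ∈ J, hmNet N A x (Sum.inl v) ≤ 1 := by
  unfold hmNet
  rw [← Summable.tsum_finsetSum fun v _ => net_summable N A x _]
  refine Real.tsum_le_of_sum_range_le
    (fun n => Finset.sum_nonneg fun v _ => netStep_nonneg _ _ _ _ _) fun n => ?_
  have := net_partial N A (fun _ => 1) (J.image Sum.inl) (by simp) (by simp) (by simp) n x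
  refine le_trans (le_of_eq ?_) this
  refine Finset.sum_congr rfl fun k _ => ?_
  rw [Finset.sum_image fun a _ b _ h => Sum.inl_injective h]

theorem hm_le (N : ℕ) (A : Set NIdx) (F : NIdx → ℝ) (y : NIdx) (h0 : ∀ x, 0 ≤ F x)
    (hY : 1 ≤ F y)
    (h : ∀ x ∉ A, ∑ z ∈ nodeNbrs N x, netCond N x z * (F z - F x) ≤ 0) (x : NIdx) :
    hmNet N A x y ≤ F x := by
  refine Real.tsum_le_of_sum_range_le (fun n => netStep_nonneg _ _ _ _ _) fun n => ?_
  simpa using net_partial N A F {y} h0 (by simpa using hY) h n x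

/-- piecewise linear extension of a lattice function to the subdivided network -/
def interpF (N : ℕ) (f : ℤ × ℤ → ℝ) : NIdx → ℝ
  | .inl u => f u
  | .inr ⟨a, b, j⟩ => if j ≤ N ^ 3 then (1 - (j : ℝ) / (N : ℝ) ^ 3) * f a + ((j : ℝ) / (N : ℝ) ^ 3) * f b
      else 0

theorem interpF_nonneg (N : ℕ) (f : ℤ × ℤ → ℝ) (hf : ∀ x, 0 ≤ f x) (x : NIdx) :
    0 ≤ interpF N f x := by
  rcases x with x | ⟨a, b, j⟩
  · exact hf x
  · simp only [interpF]
    split_ifs with h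
    · have h1 : (j : ℝ) ≤ (N : ℝ) ^ 3 := by exact_mod_cast h
      have h2 : (j : ℝ) / (N : ℝ) ^ 3 ≤ 1 := div_le_one_of_le₀ h1 (by positivity)
      have h3 : 0 ≤ (j : ℝ) / (N : ℝ) ^ 3 := by positivity
      have := mul_nonneg (sub_nonneg.2 h2) (hf a)
      have := mul_nonneg h3 (hf b)
      linarith
    · exact le_rfl

theorem interp_grid (N : ℕ) (hN : 2 ≤ N) (f : ℤ × ℤ → ℝ) (a b : ℤ × ℤ) (j : ℕ) (hj : j ≤ N ^ 3) :
    interpF N f (gridNode N a b j) =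
      (1 - (j : ℝ) / (N : ℝ) ^ 3) * f a + ((j : ℝ) / (N : ℝ) ^ 3) * f b := by
  have hM : (N : ℝ) ^ 3 ≠ 0 := by positivity
  unfold gridNode
  split_ifs with h1 h2 h3
  · simp [interpF, h1]
  · subst h2
    simp only [interpF]
    push_cast
    rw [div_self hM]; ring
  · simp [interpF, hj]
  · simp only [interpF]
    rw [if_pos (Nat.sub_le _ _), Nat.cast_sub hj]
    push_cast
    field_simp
    ring

theorem lexLt_ne (a b : ℤ × ℤ) (h : lexLt a b) : a ≠ b := by
  rintro rfl
  unfold lexLt at h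
  omega

theorem adj_lex (a b : ℤ × ℤ) (h : adj a b) (h2 : ¬ lexLt a b) : lexLt b a := by
  unfold lexLt at *
  unfold adj at h
  obtain ⟨a1, a2⟩ := a
  obtain ⟨b1, b2⟩ := b
  simp only at *
  grind

theorem interp_super (N : ℕ) (hN : 2 ≤ N) (f : ℤ × ℤ → ℝ)
    (hs : ∀ x ∈ box N, x ∉ bdry N → ∑ y ∈ nbrs x, (f y - f x) ≤ 0) (A : Set NIdx)
    (hA : ∀ x ∈ bdry N, Sum.inl x ∈ A) :
    ∀ x ∉ A, ∑ z ∈ nodeNbrs N x, netCond N x z * (interpF N f z - interpF N f x) ≤ 0 := by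
  have hM8 : 8 ≤ N ^ 3 := by
    calc 8 = 2 ^ 3 := by norm_num
      _ ≤ N ^ 3 := Nat.pow_le_pow_left hN 3
  have hM : (N : ℝ) ^ 3 ≠ 0 := by positivity
  intro x hx
  rcases x with x | ⟨a, b, j⟩
  · by_cases hxb : x ∈ box N
    swap
    · apply le_of_eq
      refine Finset.sum_eq_zero fun z hz => ?_
      have : netCond N (.inl x) z = 0 := by
        rcases z with z | ⟨a, b, j⟩
        · simp [netCond, hxb]
        · simp only [netCond]
          rw [if_neg]
          rintro ⟨ha, hb, _, _, _, _, h | h⟩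
          · exact hxb (h.1 ▸ ha)
          · exact hxb (h.1 ▸ hb)
      rw [this, zero_mul]
    have hb : x ∉ bdry N := fun h => hx (hA x h)
    have hnb := nbrs_box N x hxb hb
    have g1 : ∀ u, gridNode N x u 1 = if lexLt x u then .inr (x, u, 1) else .inr (u, x, N ^ 3 - 1) := by
      intro u
      unfold gridNode
      rw [if_neg (by norm_num), if_neg (by omega)]
    have inj : Set.InjOn (fun u => gridNode N x u 1) ↑(nbrs x) := by
      intro u _ u' _ h
      simp only [g1] at h
      split_ifs at h
      · simpa using h
      · simp only [Sum.inr.injEq, Prod.mk.injEq] at h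
        omega
      · simp only [Sum.inr.injEq, Prod.mk.injEq] at h
        omega
      · simpa using h
    have dis : Disjoint ((nbrs x).image (Sum.inl : ℤ × ℤ → NIdx))
        ((nbrs x).image fun u' => gridNode N x u' 1) := by
      rw [Finset.disjoint_left]
      intro z h1 h2
      rw [Finset.mem_image] at h1 h2
      obtain ⟨u, _, rfl⟩ := h1
      obtain ⟨u', _, h⟩ := h2
      rw [g1] at h
      split_ifs at h
    simp only [nodeNbrs]
    rw [Finset.sum_union dis, Finset.sum_image fun a _ b _ h => Sum.inl_injective h,
      Finset.sum_image inj, ← Finset.sum_add_distrib]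
    refine le_trans (le_of_eq (Finset.sum_congr rfl fun u hu => ?_)) (hs x hxb hb)
    have had := (mem_nbrs_iff x u).1 hu
    have hub := hnb u hu
    have c1 : netCond N (.inl x) (.inl u) = 7 / 8 := by
      simp only [netCond]
      rw [if_pos ⟨hxb, hub, had⟩, if_neg (by omega), add_zero]
    have c2 : netCond N (.inl x) (gridNode N x u 1) = (N : ℝ) ^ 3 / 8 := by
      rw [g1]
      split_ifs with hl
      · refine if_pos ⟨hxb, hub, had, hl, by omega, by omega, Or.inl ⟨rfl, rfl⟩⟩
      · refine if_pos ⟨hub, hxb, adj_symm _ _ had, adj_lex _ _ had hl, by omega, by omega,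
          Or.inr ⟨rfl, by omega⟩⟩
    rw [c1, c2, interp_grid N hN f x u 1 (by omega)]
    simp only [interpF]
    push_cast
    field_simp
    ring
  · by_cases hv : a ∈ box N ∧ b ∈ box N ∧ adj a b ∧ lexLt a b ∧ 0 < j ∧ j < N ^ 3
    swap
    · apply le_of_eq
      refine Finset.sum_eq_zero fun z hz => ?_
      have : netCond N (.inr (a, b, j)) z = 0 := by
        rcases z with z | ⟨a', b', j'⟩
        · simp only [netCond]
          rw [if_neg]
          tauto
        · simp only [netCond]
          rw [if_neg]
          tauto
      rw [this, zero_mul]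
    obtain ⟨ha, hb, had, hl, hj0, hj⟩ := hv
    have hab := lexLt_ne a b hl
    have ne : gridNode N a b (j - 1) ≠ gridNode N a b (j + 1) := by
      unfold gridNode
      rw [if_neg (show j + 1 ≠ 0 by omega), if_neg (show j - 1 ≠ N ^ 3 by omega), if_pos hl, if_pos hl]
      split_ifs with h1 h2 h2
      · intro h; exact hab (by simpa using h)
      · simp
      · simp
      · intro h
        simp only [Sum.inr.injEq, Prod.mk.injEq] at h
        omega
    have c1 : netCond N (.inr (a, b, j)) (gridNode N a b (j - 1)) = (N : ℝ) ^ 3 / 8 := by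
      unfold gridNode
      rw [if_neg (show j - 1 ≠ N ^ 3 by omega), if_pos hl]
      split_ifs with h1
      · refine if_pos ⟨ha, hb, had, hl, hj0, hj, Or.inl ⟨rfl, by omega⟩⟩
      · refine if_pos ⟨rfl, rfl, ha, hb, had, hl, hj0, hj, by omega, by omega, by omega⟩
    have c2 : netCond N (.inr (a, b, j)) (gridNode N a b (j + 1)) = (N : ℝ) ^ 3 / 8 := by
      unfold gridNode
      rw [if_neg (show j + 1 ≠ 0 by omega), if_pos hl]
      split_ifs with h1
      · refine if_pos ⟨ha, hb, had, hl, hj0, hj, Or.inr ⟨rfl, by omega⟩⟩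
      · refine if_pos ⟨rfl, rfl, ha, hb, had, hl, hj0, hj, by omega, by omega, by omega⟩
    apply le_of_eq
    simp only [nodeNbrs]
    rw [Finset.sum_pair ne, c1, c2, interp_grid N hN f a b _ (by omega),
      interp_grid N hN f a b _ (by omega)]
    simp only [interpF]
    rw [if_pos hj.le, Nat.cast_sub (by omega : 1 ≤ j)]
    push_cast
    field_simp
    ring

/-- logarithmic potential around `v` -/
def potR (v x : ℤ × ℤ) : ℝ := ((x.1 : ℝ) - v.1) ^ 2 + ((x.2 : ℝ) - v.2) ^ 2 + 1

theorem potR_pos (v x : ℤ × ℤ) : 1 ≤ potR v x := by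
  unfold potR; nlinarith [sq_nonneg ((x.1 : ℝ) - v.1), sq_nonneg ((x.2 : ℝ) - v.2)]

theorem log_super (v x : ℤ × ℤ) :
    4 * Real.log (potR v x) ≤ ∑ y ∈ nbrs x, Real.log (potR v y) := by
  have hp := fun y => lt_of_lt_of_le one_pos (potR_pos v y)
  rw [sum_nbrs]
  rw [← Real.log_mul (hp _).ne' (hp _).ne', ← Real.log_mul (mul_pos (hp _) (hp _)).ne' (hp _).ne',
    ← Real.log_mul (mul_pos (mul_pos (hp _) (hp _)) (hp _)).ne' (hp _).ne']
  have : 4 * Real.log (potR v x) = Real.log (potR v x ^ 4) := by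
    rw [Real.log_pow]; norm_num
  rw [this]
  refine Real.log_le_log (pow_pos (hp _) 4) ?_
  unfold potR
  push_cast
  set a := (x.1 : ℝ) - v.1
  set b := (x.2 : ℝ) - v.2
  have e1 : (x.1 : ℝ) + 1 - v.1 = a + 1 := by ring
  have e2 : (x.1 : ℝ) - 1 - v.1 = a - 1 := by ring
  have e3 : (x.2 : ℝ) + 1 - v.2 = b + 1 := by ring
  have e4 : (x.2 : ℝ) - 1 - v.2 = b - 1 := by ring
  rw [e1, e2, e3, e4]
  have key : ((a + 1) ^ 2 + b ^ 2 + 1) * ((a - 1) ^ 2 + b ^ 2 + 1) * (a ^ 2 + (b + 1) ^ 2 + 1) *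
      (a ^ 2 + (b - 1) ^ 2 + 1) - (a ^ 2 + b ^ 2 + 1) ^ 4 =
      2 * (a ^ 2 + b ^ 2 + 1) ^ 2 + 8 * (a ^ 2 + b ^ 2 + 1) + 5 + 16 * a ^ 2 * b ^ 2 := by ring
  have : 0 ≤ 2 * (a ^ 2 + b ^ 2 + 1) ^ 2 + 8 * (a ^ 2 + b ^ 2 + 1) + 5 + 16 * a ^ 2 * b ^ 2 := by
    positivity
  linarith

theorem potR_le (N : ℕ) (hN : 2 ≤ N) (v x : ℤ × ℤ) (hv : v ∈ box N) (hx : x ∈ box N) :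
    potR v x ≤ 2 * (N : ℝ) ^ 2 + 1 := by
  have h : ∀ a b : ℤ, -(((N : ℤ) - 1) / 2) ≤ a → a ≤ (N : ℤ) / 2 → -(((N : ℤ) - 1) / 2) ≤ b →
      b ≤ (N : ℤ) / 2 → ((a : ℝ) - b) ^ 2 ≤ (N : ℝ) ^ 2 := by
    intro a b h1 h2 h3 h4
    have q1 : a - b ≤ N := by omega
    have q2 : -(N : ℤ) ≤ a - b := by omega
    have q1' : (a : ℝ) - b ≤ N := by exact_mod_cast q1
    have q2' : -(N : ℝ) ≤ (a : ℝ) - b := by exact_mod_cast q2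
    exact sq_le_sq' q2' q1'
  unfold box at hv hx
  simp only [Finset.mem_product, Finset.mem_Icc] at hv hx
  have := h x.1 v.1 hx.1.1 hx.1.2 hv.1.1 hv.1.2
  have := h x.2 v.2 hx.2.1 hx.2.2 hv.2.1 hv.2.2
  unfold potR
  linarith

theorem sep_bound (β : ℝ) (h0 : 0 < β) (h1 : β < 1) (N : ℕ) (u v : ℤ × ℤ)
    (hu : u ∈ bdryR ((1 + β) * N / 2)) (hv : v ∈ boxR (β * N)) :
    ((1 - β) / 4 * N) ^ 2 / 2 ≤ potR v u := by
  unfold bdryR at hu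
  unfold boxR at hv
  set m := ⌊(1 + β) * N / 2⌋₊ with hm
  set n := ⌊β * N⌋₊ with hn
  have m1 : (1 + β) * N / 2 < m + 1 := Nat.lt_floor_add_one _
  have n1 : (n : ℝ) ≤ β * N := Nat.floor_le (by positivity)
  have key : ∀ d : ℤ, (m : ℤ) - n - 1 ≤ 2 * |d| → ((1 - β) / 4 * N) ^ 2 / 2 ≤ (d : ℝ) ^ 2 + 1 := by
    intro d hd
    have hd' : (m : ℝ) - n - 1 ≤ 2 * |(d : ℝ)| := by exact_mod_cast hd
    have h2 : (1 - β) / 4 * N ≤ |(d : ℝ)| + 1 := by linarith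
    have h3 : 0 ≤ (1 - β) / 4 * N := by
      have : 0 ≤ 1 - β := by linarith
      positivity
    have h4 := pow_le_pow_left₀ h3 h2 2
    have h5 := sq_abs (d : ℝ)
    nlinarith [sq_nonneg (|(d : ℝ)| - 1)]
  unfold bdry at hu
  rw [Finset.mem_filter] at hu
  obtain ⟨hub, y, hy, hyb⟩ := hu
  unfold box at hub hv hyb
  simp only [Finset.mem_product, Finset.mem_Icc] at hub hv hyb
  unfold nbrs at hy
  simp only [Finset.mem_insert, Finset.mem_singleton] at hy
  have hc : (m : ℤ) - n - 1 ≤ 2 * |u.1 - v.1| ∨ (m : ℤ) - n - 1 ≤ 2 * |u.2 - v.2| := by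
    have a1 := le_abs_self (u.1 - v.1)
    have a2 := neg_abs_le (u.1 - v.1)
    have a3 := le_abs_self (u.2 - v.2)
    have a4 := neg_abs_le (u.2 - v.2)
    rcases hy with rfl | rfl | rfl | rfl <;> simp only at hyb <;> omega
  unfold potR
  rcases hc with h | h
  · have := key _ h
    push_cast at this
    nlinarith [sq_nonneg ((u.2 : ℝ) - v.2)]
  · have := key _ h
    push_cast at this
    nlinarith [sq_nonneg ((u.1 : ℝ) - v.1)]

theorem hm_log (β : ℝ) (h0 : 0 < β) (h1 : β < 1) (N : ℕ) (hN : 2 ≤ N) (A : Set NIdx)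
    (hA : ∀ x ∈ bdry N, Sum.inl x ∈ A) (u v : ℤ × ℤ)
    (hu : u ∈ bdryR ((1 + β) * N / 2)) (hv : v ∈ boxR (β * N)) (hvN : v ∈ box N) :
    hmNet N A (Sum.inl u) (Sum.inl v) ≤ Real.log (6 / ((1 - β) / 4) ^ 2) / Real.log N := by
  have hNr : (2 : ℝ) ≤ N := by exact_mod_cast hN
  set M := Real.log (2 * (N : ℝ) ^ 2 + 1) with hM
  have hlN : 0 < Real.log N := Real.log_pos (by linarith)
  have hMN : Real.log N ≤ M := Real.log_le_log (by linarith) (by nlinarith)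
  have hM0 : 0 < M := by linarith
  have hc : 0 < (1 - β) / 4 := by linarith
  have hL : 0 < Real.log (6 / ((1 - β) / 4) ^ 2) := by
    apply Real.log_pos
    rw [lt_div_iff₀ (by positivity)]
    nlinarith
  set f : ℤ × ℤ → ℝ := fun x => if x ∈ box N then 1 - Real.log (potR v x) / M else 0 with hf
  have hf0 : ∀ x, 0 ≤ f x := by
    intro x
    simp only [hf]
    split_ifs with hx
    · rw [sub_nonneg, div_le_one hM0]
      exact Real.log_le_log (by linarith [potR_pos v x]) (potR_le N hN v x hvN hx)
    · exact le_rfl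
  have hfv : f v = 1 := by simp [hf, hvN, potR]
  have hs : ∀ x ∈ box N, x ∉ bdry N → ∑ y ∈ nbrs x, (f y - f x) ≤ 0 := by
    intro x hx hxb
    have e : ∑ y ∈ nbrs x, (f y - f x) =
        ∑ y ∈ nbrs x, (Real.log (potR v x) - Real.log (potR v y)) / M := by
      refine Finset.sum_congr rfl fun y hy => ?_
      simp only [hf]
      rw [if_pos hx, if_pos (nbrs_box N x hx hxb y hy)]
      ring
    rw [e, ← Finset.sum_div]
    refine div_nonpos_of_nonpos_of_nonneg ?_ hM0.le
    have := log_super v x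
    rw [sum_nbrs] at this ⊢
    linarith
  refine (hm_le N A (interpF N f) (Sum.inl v) (interpF_nonneg N f hf0) hfv.ge
    (interp_super N hN f hs A hA) (Sum.inl u)).trans ?_
  show f u ≤ _
  simp only [hf]
  split_ifs with hub
  swap
  · positivity
  have hsep := sep_bound β h0 h1 N u v hu hv
  have hpos : 0 < ((1 - β) / 4 * N) ^ 2 / 2 := by positivity
  have l1 := Real.log_le_log hpos hsep
  have l2 : M ≤ Real.log (6 / ((1 - β) / 4) ^ 2) + Real.log (((1 - β) / 4 * N) ^ 2 / 2) := by
    rw [← Real.log_mul (by positivity) hpos.ne']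
    refine Real.log_le_log (by positivity) ?_
    have : 6 / ((1 - β) / 4) ^ 2 * (((1 - β) / 4 * N) ^ 2 / 2) = 3 * (N : ℝ) ^ 2 := by
      have : (1 - β) ≠ 0 := by linarith
      field_simp
      norm_num
    rw [this]; nlinarith
  calc 1 - Real.log (potR v u) / M = (M - Real.log (potR v u)) / M := by field_simp
    _ ≤ Real.log (6 / ((1 - β) / 4) ^ 2) / M := by gcongr; linarith
    _ ≤ _ := by gcongr

theorem span_gauss {Ω ι : Type*} [MeasurableSpace Ω] (P : Measure Ω)
    (f : ι → Ω → ℝ) (K : ι → ι → ℝ) (S : Set ι) (h : IsGaussFam P f K S) (X : Ω → ℝ)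
    (hX : X ∈ Submodule.span ℝ (f '' S)) :
    Measurable X ∧ ∃ v : NNReal, P.map X = gaussianReal 0 v := by
  rw [Finsupp.mem_span_image_iff_linearCombination] at hX
  obtain ⟨l, hl, rfl⟩ := hX
  have e : Finsupp.linearCombination ℝ f l = fun ω => ∑ i ∈ l.support, l i * f i ω := by
    ext ω
    simp [Finsupp.linearCombination_apply, Finsupp.sum, Finset.sum_apply]
  rw [e]
  refine ⟨?_, _, h.2 l ((Finsupp.mem_supported ℝ l).1 hl)⟩
  have := h.1
  fun_prop

theorem cond_abs {Ω A B C : Type*} [MeasurableSpace Ω] (P : Measure Ω) [IsProbabilityMeasure P]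
    [Fintype A] [Fintype B] [Fintype C] (V : Submodule ℝ (Ω → ℝ))
    (hV : ∀ X ∈ V, Measurable X ∧ ∃ v : NNReal, P.map X = gaussianReal 0 v)
    (YA : A → Ω → ℝ) (YB : B → Ω → ℝ) (U : C → Ω → ℝ) (hYA : ∀ i, YA i ∈ V)
    (hYB : ∀ i, YB i ∈ V) (hU : ∀ i, U i ∈ V) (D : C → Set ℝ) (hD : ∀ c, MeasurableSet (D c))
    (hDc : ∀ c, ∀ x ∈ D c, ∀ y ∈ D c, (x + y) / 2 ∈ D c) (X : Ω → ℝ) (hX : X ∈ V) (κ : ℝ)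
    (hκ : 0 < κ) (hv : ∫ ω, X ω ^ 2 ∂P ≤ κ) (g : (A → ℝ) × (B → ℝ) → ℝ) (hg : Measurable g)
    (hgV : (fun ω => g ((fun i => YA i ω), (fun i => YB i ω))) ∈ V) (H : Set Ω)
    (hH : H = {ω | ∀ c, U c ω ∈ D c}) (Z : Ω → ℝ)
    (hZ : Z = fun ω => X ω + g ((fun i => YA i ω), (fun i => YB i ω))) (m : MeasurableSpace Ω)
    (hm : m = MeasurableSpace.comap (fun ω => ((fun i => YA i ω), (fun i => YB i ω))) inferInstance) :
    ∀ᵐ ω ∂P, (P[H.indicator (fun ω => Z ω ^ 2) | m]) ω *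
        (P[H.indicator (fun _ => (1 : ℝ)) | m]) ω - (P[H.indicator (fun ω => Z ω) | m]) ω ^ 2 ≤
      (4 * κ) * (P[H.indicator (fun _ => (1 : ℝ)) | m]) ω ^ 2 := by
  subst hZ hm
  have mA := fun i => (hV _ (hYA i)).1
  have mB := fun i => (hV _ (hYB i)).1
  have mU := fun i => (hV _ (hU i)).1
  have mX := (hV _ hX).1
  set Y : Ω → (A → ℝ) × (B → ℝ) := fun ω => ((fun i => YA i ω), (fun i => YB i ω)) with hYd
  have hY : Measurable Y := by fun_prop
  have hHm : MeasurableSet H := by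
    rw [hH]
    have : {ω | ∀ c, U c ω ∈ D c} = ⋂ c, U c ⁻¹' D c := by ext; simp
    rw [this]
    exact MeasurableSet.iInter fun c => mU c (hD c)
  have ml : ∀ Z ∈ V, MemLp Z 2 P := by
    intro Z hZ
    obtain ⟨h1, v, h2⟩ := hV Z hZ
    exact gauss_memLp P Z h1 v h2
  refine cond_pass' P Y hY H hHm X (ml X hX) (4 * κ) g hg (ml _ hgV) ?_
  intro y r
  let W : A ⊕ B ⊕ C ⊕ Unit → Ω → ℝ := Sum.elim YA (Sum.elim YB (Sum.elim U fun _ => X))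
  have hWV : ∀ i, W i ∈ V := by
    rintro (i | i | i | i)
    · exact hYA i
    · exact hYB i
    · exact hU i
    · exact hX
  let K : Set (A ⊕ B ⊕ C ⊕ Unit → ℝ) := {w | (∀ c, w (.inr (.inr (.inl c))) ∈ D c) ∧
    (((fun a => w (.inl a)), (fun b => w (.inr (.inl b)))) : (A → ℝ) × (B → ℝ)) ∈
      Metric.closedBall y r}
  have hK : MeasurableSet K := by
    have : K = (⋂ c, (fun w : A ⊕ B ⊕ C ⊕ Unit → ℝ => w (.inr (.inr (.inl c)))) ⁻¹' D c) ∩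
        (fun w : A ⊕ B ⊕ C ⊕ Unit → ℝ =>
          (((fun a => w (.inl a)), (fun b => w (.inr (.inl b)))) : (A → ℝ) × (B → ℝ))) ⁻¹'
          Metric.closedBall y r := by
      ext w; simp [K]
    rw [this]
    refine (MeasurableSet.iInter fun c => ?_).inter ?_
    · exact (measurable_pi_apply _) (hD c)
    · exact Measurable.comp (g := id) measurable_id (by fun_prop) Metric.isClosed_closedBall.measurableSet
  have key := gauss_cond P W (fun i => (hV _ (hWV i)).1) (fun c => ?_) K hK ?_
    (Sum.elim (fun _ => 0) (Sum.elim (fun _ => 0) (Sum.elim (fun _ => 0) fun _ => 1))) κ hκ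
  · have e1 : {ω | (fun i => W i ω) ∈ K} = H ∩ Y ⁻¹' Metric.closedBall y r := by
      rw [hH]; ext ω; rfl
    have e2 : ∀ ω, ∑ i, (Sum.elim (fun _ => 0) (Sum.elim (fun _ => 0) (Sum.elim (fun _ => 0)
        fun _ => 1)) : A ⊕ B ⊕ C ⊕ Unit → ℝ) i * W i ω = X ω := by
      intro ω; simp [W]
    rw [e1] at key
    simp only [e2] at key
    exact key hv
  · have : (∑ i, c i • W i) ∈ V := Submodule.sum_mem _ fun i _ => Submodule.smul_mem _ _ (hWV i)
    obtain ⟨_, v, h⟩ := hV _ this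
    refine ⟨v, ?_⟩
    rw [← h]
    congr 1
    ext ω
    simp [Finset.sum_apply]
  · rintro x ⟨hx1, hx2⟩ z ⟨hz1, hz2⟩
    refine ⟨fun c => hDc c _ (hx1 c) _ (hz1 c), ?_⟩
    have := (convex_closedBall y r) hx2 hz2 (by norm_num : (0 : ℝ) ≤ 1 / 2)
      (by norm_num : (0 : ℝ) ≤ 1 / 2) (by norm_num)
    convert this using 1
    ext i
    · simp; ring
    · simp; ring

theorem box_mono (m n : ℕ) (h : m ≤ n) : box m ⊆ box n := by
  intro x hx
  rw [box_mem] at *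
  omega

theorem var_bound {Ω : Type*} [MeasurableSpace Ω] (N : ℕ) (P : Measure Ω) [IsProbabilityMeasure P]
    (η : ℤ × ℤ → Ω → ℝ) (brg : (ℤ × ℤ) → (ℤ × ℤ) → Bool → ℝ → Ω → ℝ)
    (hG : IsGaussFam P (m2fam η brg) (m2Cov N) (m2Valid N)) (J : Finset (ℤ × ℤ))
    (nb : ℤ × ℤ → ℤ × ℤ) (a t : ℤ × ℤ → ℝ) (ha : ∀ v ∈ J, 0 ≤ a v)
    (ht : ∀ v ∈ J, 0 ≤ t v ∧ t v ≤ 4) (h1 : ∀ v ∈ J, v ∈ box N) (h2 : ∀ v ∈ J, nb v ∈ box N)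
    (h3 : ∀ v ∈ J, adj v (nb v)) :
    ∫ ω, (∑ v ∈ J, a v * (η v ω - mval2 η brg v (nb v) true (t v) ω)) ^ 2 ∂P ≤
      36 * ∑ v ∈ J, a v ^ 2 := by
  have S0 : 0 ≤ ∑ v ∈ J, a v ^ 2 := Finset.sum_nonneg fun v _ => sq_nonneg _
  have mη : ∀ v, Measurable (η v) := fun v => hG.1 (.inl v)
  have mb : ∀ u v b s, Measurable (brg u v b s) := fun u v b s => hG.1 (.inr (u, v, b, s))
  -- bridge part
  have hbv : ∀ v ∈ J, (Sum.inr (v, nb v, true, t v) : M2Idx) ∈ m2Valid N := by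
    intro v hv
    exact ⟨h1 v hv, h2 v hv, h3 v hv, (ht v hv).1, by simpa [edgeLen] using (ht v hv).2⟩
  set Bf : Ω → ℝ := fun ω => ∑ v ∈ J, a v * brg v (nb v) true (t v) ω with hBf
  have b1 : ∫ ω, Bf ω ^ 2 ∂P ≤ 16 * ∑ v ∈ J, a v ^ 2 :=
    fam_sq P _ _ _ hG J (fun v => (Sum.inr (v, nb v, true, t v) : M2Idx)) hbv a _ (by positivity)
      (bridge_bound N J nb a t ha ht)
  have b2 : MemLp Bf 2 P := by
    refine gauss_memLp P Bf (by fun_prop) _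
      (fam_sum P _ _ _ hG J (fun v => (Sum.inr (v, nb v, true, t v) : M2Idx)) hbv a)
  -- gradient part
  let ix : (ℤ × ℤ) × Bool → M2Idx := fun p => Sum.inl (if p.2 then p.1 else nb p.1)
  let cf : (ℤ × ℤ) × Bool → ℝ := fun p => if p.2 then a p.1 * (t p.1 / 4) else -(a p.1 * (t p.1 / 4))
  have hix : ∀ p ∈ J ×ˢ (Finset.univ : Finset Bool), ix p ∈ m2Valid N := by
    rintro ⟨v, b⟩ hp
    rw [Finset.mem_product] at hp
    cases b
    · exact h2 v hp.1
    · exact h1 v hp.1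
  set Gf : Ω → ℝ := fun ω => ∑ v ∈ J, a v * (t v / 4) * (η v ω - η (nb v) ω) with hGf
  have eG : Gf = fun ω => ∑ p ∈ J ×ˢ (Finset.univ : Finset Bool), cf p * m2fam η brg (ix p) ω := by
    ext ω
    rw [Finset.sum_product]
    refine Finset.sum_congr rfl fun v _ => ?_
    rw [Fintype.sum_bool]
    simp only [cf, ix, m2fam, if_true]
    simp
    ring
  have g1 : ∫ ω, Gf ω ^ 2 ∂P ≤ 2 * ∑ v ∈ J, a v ^ 2 := by
    rw [eG]
    refine fam_sq P _ _ _ hG _ ix hix cf _ (by positivity) ?_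
    have := grad_bound N J nb (fun v => a v * (t v / 4)) h1 h2 h3
    refine le_trans (le_of_eq ?_) (this.trans ?_)
    · rw [Finset.sum_product]
      refine Finset.sum_congr rfl fun v _ => ?_
      rw [Fintype.sum_bool, Finset.sum_product, Finset.sum_product, ← Finset.sum_add_distrib]
      refine Finset.sum_congr rfl fun w _ => ?_
      rw [Fintype.sum_bool, Fintype.sum_bool]
      simp only [cf, ix, m2Cov, if_true]
      simp
      ring
    · refine mul_le_mul_of_nonneg_left (Finset.sum_le_sum fun v hv => ?_) (by norm_num)
      rw [mul_pow]
      have h := ht v hv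
      have : (t v / 4) ^ 2 ≤ 1 := by
        rw [sq_le_one_iff₀ (by linarith)]; linarith
      nlinarith [sq_nonneg (a v)]
  have g2 : MemLp Gf 2 P := by
    refine gauss_memLp P Gf (by fun_prop) _ (eG ▸ fam_sum P _ _ _ hG _ ix hix cf)
  have i1 := b2.integrable_sq
  have i2 := g2.integrable_sq
  have e : ∀ ω, ∑ v ∈ J, a v * (η v ω - mval2 η brg v (nb v) true (t v) ω) = Gf ω - Bf ω := by
    intro ω
    rw [hGf, hBf]
    simp only
    rw [← Finset.sum_sub_distrib]
    refine Finset.sum_congr rfl fun v _ => ?_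
    simp only [mval2, edgeLen, if_true]
    ring
  simp only [e]
  calc ∫ ω, (Gf ω - Bf ω) ^ 2 ∂P ≤ ∫ ω, (2 * Gf ω ^ 2 + 2 * Bf ω ^ 2) ∂P := by
        refine integral_mono (g2.sub b2).integrable_sq ((i2.const_mul 2).add (i1.const_mul 2)) ?_
        intro ω
        simp only
        nlinarith [sq_nonneg (Gf ω + Bf ω)]
    _ = 2 * ∫ ω, Gf ω ^ 2 ∂P + 2 * ∫ ω, Bf ω ^ 2 ∂P := by
        rw [integral_add (i2.const_mul 2) (i1.const_mul 2), integral_const_mul, integral_const_mul]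
    _ ≤ _ := by linarith

/-- There is `C₄ > 0` such that for every admissible realization of the
exploration at stage `k` and every (a.e.) choice of prescribed values defining the events
`H_=, H₊, H₋`, one has `Var(X₃ | H_=, H₊, H₋) ≤ C₄ / log N`.  Conditioning on the prescribed
values (`H_=`) is expressed through the conditional expectation with respect to the σ-algebra
they generate, so the conclusion reads
`𝔼[X₃² 1_H | σ(H_=)] 𝔼[1_H | σ(H_=)] - 𝔼[X₃ 1_H | σ(H_=)]² ≤ (C₄/log N) 𝔼[1_H | σ(H_=)]²`
(with `H = H₊ ∩ H₋`) almost everywhere on the event that the values on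
`B₀ ∪ B^{=λ}_k ∪ B^{=-λ}_k` lie in the admissible ranges. -/
theorem stmt15 (α β lam : ℝ) (hα : 0 < α) (hαβ : α < β) (hβ : β < 1) (hlam : 0 < lam) :
    ∃ C₄ > (0 : ℝ), ∀ N : ℕ, 2 ≤ N →
      ∀ (Ω : Type) (_ : MeasurableSpace Ω) (P : Measure Ω), IsProbabilityMeasure P →
        ∀ (η : ℤ × ℤ → Ω → ℝ) (brg : (ℤ × ℤ) → (ℤ × ℤ) → Bool → ℝ → Ω → ℝ),
          IsMetricGFF2 N P η brg →
          ∀ (Ip Im Bp Bm : Finset PPt) (B0 J3 : Finset (ℤ × ℤ)),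
            (∀ q ∈ Ip ∪ Im ∪ Bp ∪ Bm, pValid N q) →
            (∀ q ∈ Ip ∪ Im, outsideAlpha α N q) →
            (∀ q ∈ Ip ∪ Im ∪ Bp ∪ Bm, q.1 ∈ boxR (β * N) ∧ q.2.1 ∈ boxR (β * N)) →
            B0 ⊆ bdryR (α * N) →
            -- `J₃`: lattice points explored by stage `k` carrying a `B`-point on an
            -- incident `e(1)` edge
            (∀ v ∈ J3, v ∈ box N ∧ v ∉ boxR (α * N) ∧
              (∃ q ∈ Ip ∪ Im, nodeOf N q = Sum.inl v) ∧
              ∃ v' : ℤ × ℤ, ∃ j : ℕ, adj v v' ∧ v' ∈ box N ∧ j ≤ N ^ 3 ∧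
                ((v, v', j) ∈ Bp ∪ Bm ∨ (v', v, j) ∈ Bp ∪ Bm)) →
            -- admissibility: the realization occurs with positive probability
            0 < P (eventRng N η brg lam B0 Bp Bm ∩ eventH N η brg lam Ip Im) →
            ∀ᵐ ω ∂P, ω ∈ eventRng N η brg lam B0 Bp Bm →
              (P[(eventH N η brg lam Ip Im).indicator
                    (fun ω' => (X3 N β Ip Im Bp Bm B0 J3 η ω') ^ 2) |
                  condSigma N η brg B0 Bp Bm]) ω *
                  (P[(eventH N η brg lam Ip Im).indicator (fun _ => (1 : ℝ)) |
                      condSigma N η brg B0 Bp Bm]) ω -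
                ((P[(eventH N η brg lam Ip Im).indicator
                      (fun ω' => X3 N β Ip Im Bp Bm B0 J3 η ω') |
                    condSigma N η brg B0 Bp Bm]) ω) ^ 2 ≤
                (C₄ / Real.log N) *
                  ((P[(eventH N η brg lam Ip Im).indicator (fun _ => (1 : ℝ)) |
                      condSigma N η brg B0 Bp Bm]) ω) ^ 2 := by
  have hβ0 : 0 < β := hα.trans hαβ
  set L := Real.log (6 / ((1 - β) / 4) ^ 2) with hLd
  have hL : 0 < L := by
    have : 0 < 1 - β := by linarith
    apply Real.log_pos
    rw [lt_div_iff₀ (by positivity)]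
    nlinarith
  refine ⟨144 * L, by positivity, ?_⟩
  intro N hN Ω mΩ P hP η brg hgff Ip Im Bp Bm B0 J3 hval _ hbox hB0 hJ3 _
  have hNr : (2 : ℝ) ≤ N := by exact_mod_cast hN
  have hlN : 0 < Real.log N := Real.log_pos (by linarith)
  obtain ⟨hG, _, _, hsym, _⟩ := hgff
  set A : Set NIdx := ↑(targetNodes N Ip Im Bp Bm B0) with hAd
  have hA : ∀ x ∈ bdry N, Sum.inl x ∈ A := by
    intro x hx
    rw [hAd, Finset.mem_coe, targetNodes, Finset.mem_union]
    exact Or.inr (Finset.mem_image_of_mem _ hx)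
  -- weights
  set Q := bdryR ((1 + β) * N / 2) with hQ
  set a : ℤ × ℤ → ℝ := fun v => ((Q.card : ℝ))⁻¹ * ∑ u ∈ Q, hmNet N A (Sum.inl u) (Sum.inl v) with ha
  have ha0 : ∀ v, 0 ≤ a v := fun v =>
    mul_nonneg (inv_nonneg.2 (Nat.cast_nonneg _)) (Finset.sum_nonneg fun u _ => hm_nonneg _ _ _ _)
  have avg : ∀ (F : ℤ × ℤ → ℝ) (b : ℝ), 0 ≤ b → (∀ u ∈ Q, F u ≤ b) →
      ((Q.card : ℝ))⁻¹ * ∑ u ∈ Q, F u ≤ b := by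
    intro F b hb hF
    have h1 : ∑ u ∈ Q, F u ≤ Q.card * b := by
      rw [← nsmul_eq_mul]
      exact Finset.sum_le_card_nsmul Q F b hF
    rcases Nat.eq_zero_or_pos Q.card with h | h
    · rw [h, Nat.cast_zero, inv_zero, zero_mul]; exact hb
    · have h' : (0 : ℝ) < Q.card := by exact_mod_cast h
      rw [inv_mul_le_iff₀ h']; exact h1
  have hvβ : ∀ v ∈ J3, v ∈ boxR (β * N) := by
    intro v hv
    obtain ⟨_, _, ⟨q, hq, hqv⟩, _⟩ := hJ3 v hv
    have hb := hbox q (by rw [Finset.mem_union, Finset.mem_union]; exact Or.inl (Or.inl hq))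
    unfold nodeOf gridNode at hqv
    split_ifs at hqv
    · rw [← Sum.inl_injective hqv]; exact hb.1
    · rw [← Sum.inl_injective hqv]; exact hb.2
  have haL : ∀ v ∈ J3, a v ≤ L / Real.log N := by
    intro v hv
    refine avg _ _ (by positivity) fun u hu => ?_
    exact hm_log β hβ0 hβ N hN A hA u v hu (hvβ v hv) (hJ3 v hv).1
  have hasum : ∑ v ∈ J3, a v ≤ 1 := by
    simp only [ha]
    rw [← Finset.mul_sum, Finset.sum_comm]
    exact avg _ _ zero_le_one fun u _ => hm_total N A _ J3
  have hsq : ∑ v ∈ J3, a v ^ 2 ≤ L / Real.log N := by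
    calc ∑ v ∈ J3, a v ^ 2 ≤ ∑ v ∈ J3, (L / Real.log N) * a v := by
          refine Finset.sum_le_sum fun v hv => ?_
          rw [sq]
          exact mul_le_mul_of_nonneg_right (haL v hv) (ha0 v)
      _ = (L / Real.log N) * ∑ v ∈ J3, a v := by rw [Finset.mul_sum]
      _ ≤ _ := mul_le_of_le_one_right (by positivity) hasum
  -- choice of boundary points
  have hch : ∀ v ∈ J3, ∃ (v' : ℤ × ℤ) (t : ℝ) (b : PPt), adj v v' ∧ v' ∈ box N ∧ (0 ≤ t ∧ t ≤ 4) ∧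
      b ∈ Bp ∪ Bm ∧ ∀ ω, pval N η brg b ω = mval2 η brg v v' true t ω := by
    intro v hv
    obtain ⟨_, _, _, v', j, had, hv', hj, h | h⟩ := hJ3 v hv
    · have hj' : (j : ℝ) ≤ (N : ℝ) ^ 3 := by exact_mod_cast hj
      refine ⟨v', 4 * (j : ℝ) / (N : ℝ) ^ 3, _, had, hv', ⟨by positivity, ?_⟩, h, fun ω => rfl⟩
      rw [div_le_iff₀ (by positivity)]; linarith
    · have hj' : (j : ℝ) ≤ (N : ℝ) ^ 3 := by exact_mod_cast hj
      have hle : 4 * (j : ℝ) / (N : ℝ) ^ 3 ≤ 4 := by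
        rw [div_le_iff₀ (by positivity)]; linarith
      have hge : 0 ≤ 4 * (j : ℝ) / (N : ℝ) ^ 3 := by positivity
      refine ⟨v', 4 - 4 * (j : ℝ) / (N : ℝ) ^ 3, _, had, hv', ⟨by linarith, by linarith⟩, h,
        fun ω => ?_⟩
      simp only [pval, mval2]
      rw [hsym v' v true]
      simp only [edgeLen, if_true]
      ring
  choose! nb t b h3 h2 ht hb hpv using hch
  have h1 : ∀ v ∈ J3, v ∈ box N := fun v hv => (hJ3 v hv).1
  have hvar := var_bound N P η brg hG J3 nb a t (fun v _ => ha0 v) ht h1 h2 h3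
  -- the linear span
  set V := Submodule.span ℝ (m2fam η brg '' m2Valid N) with hVd
  have hV := span_gauss P (m2fam η brg) (m2Cov N) (m2Valid N) hG
  have hηV : ∀ v ∈ box N, η v ∈ V := fun v hv => Submodule.subset_span ⟨.inl v, hv, rfl⟩
  have hpV : ∀ q, pValid N q → (fun ω => pval N η brg q ω) ∈ V := by
    rintro ⟨u, v, j⟩ ⟨q1, q2, q3, q4⟩
    have hj' : (j : ℝ) ≤ (N : ℝ) ^ 3 := by exact_mod_cast q4
    have hle : 4 * (j : ℝ) / (N : ℝ) ^ 3 ≤ 4 := by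
      rw [div_le_iff₀ (by positivity)]; linarith
    have hbr : brg u v true (4 * (j : ℝ) / (N : ℝ) ^ 3) ∈ V :=
      Submodule.subset_span ⟨.inr (u, v, true, 4 * (j : ℝ) / (N : ℝ) ^ 3),
        ⟨q1, q2, q3, by positivity, by simpa [edgeLen] using hle⟩, rfl⟩
    exact V.add_mem (V.add_mem (V.smul_mem _ (hηV u q1)) (V.smul_mem _ (hηV v q2))) hbr
  have hαβN : ∀ x ∈ B0, x ∈ box N := by
    intro x hx
    have h := hB0 hx
    unfold bdryR bdry at h
    refine box_mono _ N ?_ (Finset.mem_filter.1 h).1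
    refine Nat.floor_le_of_le ?_
    nlinarith
  have hvb : ∀ v ∈ J3, pValid N (b v) := by
    intro v hv
    refine hval _ ?_
    have := hb v hv
    simp only [Finset.mem_union] at this ⊢
    tauto
  set X : Ω → ℝ := fun ω => ∑ v ∈ J3, a v * (η v ω - mval2 η brg v (nb v) true (t v) ω) with hXd
  have hX' : X = ∑ v ∈ J3, a v • (η v - fun ω => pval N η brg (b v) ω) := by
    ext ω
    rw [Finset.sum_apply]
    refine Finset.sum_congr rfl fun v hv => ?_
    simp [hpv v hv]
  have hXV : X ∈ V := by
    rw [hX']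
    exact Submodule.sum_mem _ fun v hv => V.smul_mem _ (V.sub_mem (hηV v (h1 v hv)) (hpV _ (hvb v hv)))
  let g : ({x // x ∈ B0} → ℝ) × ({q // q ∈ Bp ∪ Bm} → ℝ) → ℝ :=
    fun y => ∑ v ∈ J3.attach, a v.1 * y.2 ⟨b v.1, hb v.1 v.2⟩
  have hg : Measurable g := by
    refine Finset.measurable_sum _ fun v _ => ?_
    exact ((measurable_pi_apply _).comp measurable_snd).const_mul _
  have hgY : ∀ ω, g ((fun x => η x.1 ω), (fun q => pval N η brg q.1 ω)) =
      ∑ v ∈ J3, a v * pval N η brg (b v) ω := by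
    intro ω
    exact Finset.sum_attach J3 fun v => a v * pval N η brg (b v) ω
  have hgV : (fun ω => g ((fun x => η x.1 ω), (fun q => pval N η brg q.1 ω))) ∈ V := by
    have : (fun ω => g ((fun x => η x.1 ω), (fun q => pval N η brg q.1 ω))) =
        ∑ v ∈ J3, a v • (fun ω => pval N η brg (b v) ω) := by
      ext ω
      rw [hgY, Finset.sum_apply]
      rfl
    rw [this]
    exact Submodule.sum_mem _ fun v hv => V.smul_mem _ (hpV _ (hvb v hv))
  have main := cond_abs P V hV (fun x : {x // x ∈ B0} => η x.1)
    (fun q : {q // q ∈ Bp ∪ Bm} => fun ω => pval N η brg q.1 ω)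
    (fun q : {q // q ∈ Ip ∪ Im} => fun ω => pval N η brg q.1 ω)
    (fun x => hηV _ (hαβN _ x.2))
    (fun q => hpV _ (hval _ (by
      have := q.2
      simp only [Finset.mem_union] at this ⊢
      tauto)))
    (fun q => hpV _ (hval _ (by
      have := q.2
      simp only [Finset.mem_union] at this ⊢
      tauto)))
    (fun q => {x | (q.1 ∈ Ip → lam + 1 / N < x) ∧ (q.1 ∈ Im → x < -(lam + 1 / N))})
    (fun q => by
      by_cases c1 : q.1 ∈ Ip <;> by_cases c2 : q.1 ∈ Im <;> simp only [c1, c2, true_imp_iff, false_imp_iff,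
        and_true, true_and, Set.ofPred_true, MeasurableSet.univ]
      · exact measurableSet_Ioo
      · exact measurableSet_Ioi
      · exact measurableSet_Iio)
    (fun q x hx y hy => ⟨fun h => by have := hx.1 h; have := hy.1 h; linarith,
      fun h => by have := hx.2 h; have := hy.2 h; linarith⟩)
    X hXV (36 * (L / Real.log N)) (by positivity) (hvar.trans (by linarith)) g hg hgV
    (eventH N η brg lam Ip Im)
    (by
      ext ω
      simp only [eventH, Set.mem_ofPred_eq, Subtype.forall, Finset.mem_union]
      constructor
      · rintro ⟨e1, e2⟩ q _
        exact ⟨e1 q, e2 q⟩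
      · intro h
        exact ⟨fun q hq => (h q (Or.inl hq)).1 hq, fun q hq => (h q (Or.inr hq)).2 hq⟩)
    (fun ω => X3 N β Ip Im Bp Bm B0 J3 η ω)
    (by
      ext ω
      rw [hgY, hXd]
      simp only
      rw [← Finset.sum_add_distrib]
      have : ∑ v ∈ J3, (a v * (η v ω - mval2 η brg v (nb v) true (t v) ω) +
          a v * pval N η brg (b v) ω) = ∑ v ∈ J3, a v * η v ω := by
        refine Finset.sum_congr rfl fun v hv => ?_
        rw [hpv v hv]; ring
      rw [this]
      unfold X3
      simp only [ha]
      rw [Finset.sum_comm, Finset.mul_sum]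
      refine Finset.sum_congr rfl fun v _ => ?_
      rw [← Finset.sum_mul, mul_assoc])
    (condSigma N η brg B0 Bp Bm) rfl
  filter_upwards [main] with ω hω _
  refine hω.trans (le_of_eq ?_)
  ring

end
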